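/- Let f : ℝⁿ → ℝⁿ have polynomial components, let B = {x ∈ ℝⁿ : g_i(x) ≥ 0 for i = 1,…,I, h_j(x) = 0 for j = 1,…,J} for polynomials g_i, h_j be compact and forward invariant under ẋ = f(x), and suppose the specification is Archimedean: there exist R ∈ ℝ, SOS polynomials τ₀,…,τ_I and polynomials π₁,…,π_J with R − Σ_{k=1}^n x_k² = τ₀ + Σ_{i=1}^I τ_i g_i + Σ_{j=1}^J π_j h_j. Let h₀(z) = 1 − ‖z‖², and for a constant U and V ∈ ℝ[x,z] define P(x,z) = U − ⟨z, Df(x) z⟩ − f(x)·∇ₓV(x,z) − [Df(x) z − ⟨z, Df(x) z⟩ z]·∇_zV(x,z). Then the maximal Lyapunov exponent μ*_B equals the infimum of U over all U ∈ ℝ, V, ρ₀,…,ρ_J ∈ ℝ[x,z], and SOS σ₁,…,σ_I ∈ ℝ[x,z] such that P − Σ_{i=1}^I σ_i g_i − Σ_{j=0}^J ρ_j h_j is SOS. -/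

import Mathlib

open Filter MeasureTheory MvPolynomial

/-- A polynomial is a sum of squares if it is a finite sum of squares of polynomials. -/
def IsSOS {σ : Type*} (p : MvPolynomial σ ℝ) : Prop :=
  ∃ (K : ℕ) (q : Fin K → MvPolynomial σ ℝ), p = ∑ k, q k ^ 2

/-- The polynomial `Φ(x,z) = ⟨z, Df(x) z⟩` in the `2n` variables `(x, z)`, where the vector
field `f` has polynomial components `F`. -/
noncomputable def PhiPoly {n : ℕ} (F : Fin n → MvPolynomial (Fin n) ℝ) :
    MvPolynomial (Fin n ⊕ Fin n) ℝ :=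
  ∑ k, ∑ i, X (Sum.inr k) * rename Sum.inl (pderiv i (F k)) * X (Sum.inr i)

/-- The polynomial
`P(x,z) = U − ⟨z, Df(x) z⟩ − f(x)·∇ₓV(x,z) − [Df(x) z − ⟨z, Df(x) z⟩ z]·∇_zV(x,z)`
in the `2n` variables `(x, z)`, where `f` has polynomial components `F`. -/
noncomputable def Ppoly {n : ℕ} (F : Fin n → MvPolynomial (Fin n) ℝ) (U : ℝ)
    (V : MvPolynomial (Fin n ⊕ Fin n) ℝ) : MvPolynomial (Fin n ⊕ Fin n) ℝ :=
  C U - PhiPoly F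
    - ∑ i, rename Sum.inl (F i) * pderiv (Sum.inl i) V
    - ∑ k, ((∑ i, rename Sum.inl (pderiv i (F k)) * X (Sum.inr i))
        - PhiPoly F * X (Sum.inr k)) * pderiv (Sum.inr k) V

/-- The polynomial `h₀(z) = 1 − ‖z‖²` in the `2n` variables `(x, z)`. -/
noncomputable def hZero (n : ℕ) : MvPolynomial (Fin n ⊕ Fin n) ℝ :=
  1 - ∑ i, X (Sum.inr i) ^ 2

/-- An Archimedean quadratic module. -/
structure ArchQM {σ : Type*} (Q : Set (MvPolynomial σ ℝ)) : Prop where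
  add : ∀ p ∈ Q, ∀ q ∈ Q, p + q ∈ Q
  sq : ∀ a : MvPolynomial σ ℝ, a ^ 2 ∈ Q
  sq_mul : ∀ a : MvPolynomial σ ℝ, ∀ q ∈ Q, a ^ 2 * q ∈ Q
  arch : ∀ i, ∃ N : ℝ, C N - X i ^ 2 ∈ Q

namespace ArchQM
variable {σ : Type*} {Q : Set (MvPolynomial σ ℝ)}

theorem const_mem (hQ : ArchQM Q) {c : ℝ} (hc : 0 ≤ c) : (C c : MvPolynomial σ ℝ) ∈ Q := by
  have := hQ.sq (C (Real.sqrt c))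
  rwa [← C_pow, Real.sq_sqrt hc] at this

theorem smul_mem (hQ : ArchQM Q) {c : ℝ} (hc : 0 ≤ c) {q : MvPolynomial σ ℝ} (hq : q ∈ Q) :
    c • q ∈ Q := by
  have := hQ.sq_mul (C (Real.sqrt c)) q hq
  rwa [← C_pow, Real.sq_sqrt hc, ← smul_eq_C_mul] at this

theorem bound_sq (hQ : ArchQM Q) (a : MvPolynomial σ ℝ) :
    ∃ N : ℝ, 0 < N ∧ C N - a ^ 2 ∈ Q := by
  have key : ∀ a : MvPolynomial σ ℝ, (∃ N : ℝ, C N - a ^ 2 ∈ Q) →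
      ∃ N : ℝ, 0 < N ∧ C N - a ^ 2 ∈ Q := by
    rintro a ⟨N, hN⟩
    refine ⟨|N| + 1, by positivity, ?_⟩
    have := hQ.add _ hN _ (hQ.const_mem (c := |N| + 1 - N) (by linarith [le_abs_self N]))
    convert this using 1
    simp only [C_sub, C_add]; ring
  have mul : ∀ a b : MvPolynomial σ ℝ, (∃ N : ℝ, 0 < N ∧ C N - a ^ 2 ∈ Q) →
      (∃ N : ℝ, 0 < N ∧ C N - b ^ 2 ∈ Q) → ∃ N : ℝ, 0 < N ∧ C N - (a * b) ^ 2 ∈ Q := by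
    rintro a b ⟨N, hN0, hN⟩ ⟨M, hM0, hM⟩
    refine ⟨N * M, by positivity, ?_⟩
    have := hQ.add _ (hQ.smul_mem hM0.le hN) _ (hQ.sq_mul a _ hM)
    convert this using 1
    simp only [C_mul, smul_eq_C_mul]; ring
  induction a using MvPolynomial.induction_on with
  | C c => exact ⟨c ^ 2 + 1, by positivity, by
      rw [← C_pow, ← C_sub]; exact hQ.const_mem (by linarith)⟩
  | add p q hp hq =>
    obtain ⟨N, hN0, hN⟩ := hp
    obtain ⟨M, hM0, hM⟩ := hq
    refine ⟨2 * N + 2 * M, by positivity, ?_⟩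
    have := hQ.add _ (hQ.add _ (hQ.smul_mem (c := 2) (by norm_num) hN) _
      (hQ.smul_mem (c := 2) (by norm_num) hM)) _ (hQ.sq (p - q))
    convert this using 1
    simp only [C_mul, smul_eq_C_mul, C_add]
    rw [show (C 2 : MvPolynomial σ ℝ) = 2 from rfl]; ring
  | mul_X p i hp => exact mul _ _ hp (key _ (hQ.arch i))

theorem bound (hQ : ArchQM Q) (a : MvPolynomial σ ℝ) :
    ∃ N : ℝ, C N + a ∈ Q := by
  obtain ⟨N, hN0, hN⟩ := hQ.bound_sq a
  refine ⟨(N + 1) / 2, ?_⟩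
  have := hQ.smul_mem (c := 1/2) (by norm_num) (hQ.add _ hN _ (hQ.sq (a + 1)))
  convert this using 1
  have : (C (1/2) : MvPolynomial σ ℝ) * 2 = 1 := by
    rw [show (2 : MvPolynomial σ ℝ) = C 2 from rfl, ← C_mul]; norm_num
  rw [smul_eq_C_mul, show (N+1)/2 = 1/2 * N + 1/2 by ring]
  simp only [C_add, C_mul]
  linear_combination (-a) * this

/-- A state: a normalized positive functional. -/
def IsState (Q : Set (MvPolynomial σ ℝ)) (L : MvPolynomial σ ℝ →ₗ[ℝ] ℝ) : Prop :=
  (∀ q ∈ Q, 0 ≤ L q) ∧ L 1 = 1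

/-- Cauchy–Schwarz for a functional nonnegative on squares. -/
theorem cauchy (L : MvPolynomial σ ℝ →ₗ[ℝ] ℝ) (hL : ∀ a, 0 ≤ L (a ^ 2))
    (a b : MvPolynomial σ ℝ) : L (a * b) ^ 2 ≤ L (a ^ 2) * L (b ^ 2) := by
  have h : ∀ t : ℝ, 0 ≤ L (b ^ 2) * (t * t) + (2 * L (a * b)) * t + L (a ^ 2) := by
    intro t
    have := hL (t • b + a)
    have e : (t • b + a) ^ 2 = (t * t) • b ^ 2 + (2 * t) • (a * b) + a ^ 2 := by
      simp only [smul_eq_C_mul, C_mul]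
      rw [show (C 2 : MvPolynomial σ ℝ) = 2 from rfl]; ring
    rw [e] at this
    simp only [map_add, map_smul, smul_eq_mul] at this
    linarith
  have := discrim_le_zero h
  unfold discrim at this
  nlinarith

/-- multiplication by a fixed polynomial composed with `L`. -/
noncomputable def mulL (L : MvPolynomial σ ℝ →ₗ[ℝ] ℝ) (m : MvPolynomial σ ℝ) :
    MvPolynomial σ ℝ →ₗ[ℝ] ℝ := L ∘ₗ LinearMap.mulLeft ℝ m

@[simp] theorem mulL_apply (L : MvPolynomial σ ℝ →ₗ[ℝ] ℝ) (m b : MvPolynomial σ ℝ) :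
    mulL L m b = L (m * b) := rfl

theorem pow_bound {s C : ℝ} (h : ∀ k : ℕ, s ^ (2 ^ k) ≤ C) : s ≤ 1 := by
  by_contra hs
  push Not at hs
  obtain ⟨n, hn⟩ := pow_unbounded_of_one_lt C hs
  have h1 := h n
  have : s ^ n ≤ s ^ (2 ^ n) := pow_le_pow_right₀ hs.le (Nat.lt_two_pow_self).le
  linarith

theorem pow_mem (hQ : ArchQM Q) {a : MvPolynomial σ ℝ} {N : ℝ} (hN0 : 0 < N)
    (hN : C N - a ^ 2 ∈ Q) (k : ℕ) : C (N ^ k) - (a ^ k) ^ 2 ∈ Q := by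
  induction k with
  | zero => simpa using hQ.const_mem (c := 0) le_rfl
  | succ k ih =>
    have := hQ.add _ (hQ.smul_mem hN0.le ih) _ (hQ.sq_mul (a ^ k) _ hN)
    convert this using 1
    simp only [C_mul, smul_eq_C_mul, C_pow]; ring

theorem key_bound (hQ : ArchQM Q) {L : MvPolynomial σ ℝ →ₗ[ℝ] ℝ} (hL : IsState Q L)
    {a : MvPolynomial σ ℝ} {N : ℝ} (hN0 : 0 < N) (hN : C N - a ^ 2 ∈ Q)
    {m : MvPolynomial σ ℝ} (hm : m ∈ Q) : 0 ≤ L ((C N - a ^ 2) * m) := by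
  have hsq : ∀ b, 0 ≤ mulL L m (b ^ 2) := fun b => by
    rw [mulL_apply, mul_comm]; exact hL.1 _ (hQ.sq_mul b m hm)
  have hCS := cauchy (mulL L m) hsq
  simp only [mulL_apply] at hsq hCS
  have h1 : 0 ≤ L m := hL.1 _ hm
  have h2 : 0 ≤ L (m * a ^ 2) := hsq a
  have goal : L (m * a ^ 2) ≤ N * L m := by
    rcases h1.eq_or_lt with h0 | hpos
    · have := hCS 1 (a ^ 2)
      simp only [one_pow, mul_one, ← h0, zero_mul, one_mul] at this
      have : L (m * a ^ 2) = 0 := by nlinarith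
      rw [this, ← h0]; simp
    · -- power trick
      set c : ℝ := L m with hc
      have hind : ∀ k : ℕ, (L (m * a ^ 2) / c) ^ (2 ^ k) ≤ L (m * (a ^ (2 ^ k)) ^ 2) / c := by
        intro k
        induction k with
        | zero => simp
        | succ k ih =>
          have h3 := hCS 1 ((a ^ (2 ^ k)) ^ 2)
          simp only [one_pow, mul_one, one_mul] at h3
          have e : ((a ^ 2 ^ k) ^ 2) ^ 2 = (a ^ 2 ^ (k+1)) ^ 2 := by
            rw [pow_succ 2 k, pow_mul a]
          rw [e, ← hc] at h3
          rw [pow_succ 2 k, pow_mul (L (m * a ^ 2) / c)]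
          calc ((L (m * a ^ 2) / c) ^ 2 ^ k) ^ 2 ≤ (L (m * (a ^ 2 ^ k) ^ 2) / c) ^ 2 := by
                apply pow_le_pow_left₀ _ ih; positivity
            _ ≤ _ := by
                rw [div_pow, div_le_div_iff₀ (by positivity) hpos]
                rw [← pow_succ 2 k]
                nlinarith
      have hL2 : ∀ k : ℕ, L (m * (a ^ (2 ^ k)) ^ 2) ≤ (L (m ^ 2) + 1) * N ^ (2 ^ k) := by
        intro k
        have h4 := cauchy L (fun b => hL.1 _ (hQ.sq b)) m ((a ^ (2 ^ k)) ^ 2)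
        have h5 := hL.1 _ (hQ.pow_mem hN0 hN (2 ^ (k+1)))
        have e1 : L (C (N ^ 2 ^ (k+1))) = N ^ 2 ^ (k+1) := by
          rw [← mul_one (C _ : MvPolynomial σ ℝ), ← smul_eq_C_mul, map_smul, hL.2]; simp
        rw [map_sub, e1] at h5
        have e : ((a ^ 2 ^ k) ^ 2) ^ 2 = (a ^ 2 ^ (k+1)) ^ 2 := by
          rw [pow_succ 2 k, pow_mul a]
        rw [e] at h4
        have e2 : N ^ 2 ^ (k+1) = (N ^ 2 ^ k) ^ 2 := by rw [pow_succ 2 k, pow_mul]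
        have hm2 : 0 ≤ L (m ^ 2) := hL.1 _ (hQ.sq m)
        have hNp : 0 < N ^ 2 ^ k := by positivity
        apply abs_le_of_sq_le_sq' _ (by positivity) |>.2
        calc _ ≤ _ := h4
          _ ≤ L (m ^ 2) * (N ^ 2 ^ k) ^ 2 := by
            apply mul_le_mul_of_nonneg_left _ hm2; rw [← e2]; linarith
          _ ≤ _ := by
            rw [mul_pow]; apply mul_le_mul_of_nonneg_right _ (by positivity); nlinarith
      have : L (m * a ^ 2) / c / N ≤ 1 := by
        apply pow_bound (C := (L (m ^ 2) + 1) / c)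
        intro k
        rw [div_pow, div_le_iff₀ (by positivity)]
        refine (hind k).trans ?_
        rw [div_mul_eq_mul_div]
        exact div_le_div_of_nonneg_right (hL2 k) hpos.le
      rw [div_div, div_le_one (by positivity)] at this
      linarith
  rw [sub_mul, map_sub, ← smul_eq_C_mul, map_smul, smul_eq_mul, mul_comm (a ^ 2)]
  linarith

end ArchQM

namespace ArchQM
variable {σ : Type*} {Q : Set (MvPolynomial σ ℝ)}

/-- The set of states, as functions. -/
def stateSet (Q : Set (MvPolynomial σ ℝ)) : Set (MvPolynomial σ ℝ → ℝ) :=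
  {φ | (∀ a b, φ (a + b) = φ a + φ b) ∧ (∀ (c : ℝ) a, φ (c • a) = c * φ a) ∧
    (∀ q ∈ Q, 0 ≤ φ q) ∧ φ 1 = 1}

theorem coe_mem_stateSet {L : MvPolynomial σ ℝ →ₗ[ℝ] ℝ} (hL : IsState Q L) :
    (L : MvPolynomial σ ℝ → ℝ) ∈ stateSet Q :=
  ⟨fun a b => map_add L a b, fun c a => by simp, hL.1, hL.2⟩

theorem exists_of_mem_stateSet {φ : MvPolynomial σ ℝ → ℝ} (h : φ ∈ stateSet Q) :
    ∃ L : MvPolynomial σ ℝ →ₗ[ℝ] ℝ, IsState Q L ∧ (L : MvPolynomial σ ℝ → ℝ) = φ :=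
  ⟨⟨⟨φ, h.1⟩, h.2.1⟩, ⟨h.2.2.1, h.2.2.2⟩, rfl⟩

theorem map_C {L : MvPolynomial σ ℝ →ₗ[ℝ] ℝ} (hL : L 1 = 1) (c : ℝ) : L (C c) = c := by
  rw [← mul_one (C _ : MvPolynomial σ ℝ), ← smul_eq_C_mul, map_smul, hL]; simp

theorem isCompact_stateSet (hQ : ArchQM Q) : IsCompact (stateSet Q) := by
  choose N hN using hQ.bound
  have hsub : stateSet Q ⊆ Set.pi Set.univ (fun a => Set.Icc (-(N a)) (N (-a))) := by
    intro φ hφ a _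
    obtain ⟨L, hL, rfl⟩ := exists_of_mem_stateSet hφ
    have h1 := hL.1 _ (hN a)
    have h2 := hL.1 _ (hN (-a))
    rw [map_add, map_C hL.2] at h1 h2
    rw [map_neg] at h2
    constructor <;> linarith
  refine IsCompact.of_isClosed_subset (isCompact_univ_pi fun a => isCompact_Icc) ?_ hsub
  have : stateSet Q = (⋂ a, ⋂ b, {φ | φ (a + b) = φ a + φ b}) ∩
      ((⋂ (c : ℝ), ⋂ a, {φ | φ (c • a) = c * φ a}) ∩
      ((⋂ q ∈ Q, {φ | 0 ≤ φ q}) ∩ {φ | φ 1 = 1})) := by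
    ext φ; simp [stateSet]
  rw [this]
  refine IsClosed.inter ?_ (IsClosed.inter ?_ (IsClosed.inter ?_ ?_))
  · exact isClosed_iInter fun a => isClosed_iInter fun b => isClosed_eq (by fun_prop) (by fun_prop)
  · exact isClosed_iInter fun a => isClosed_iInter fun b => isClosed_eq (by fun_prop) (by fun_prop)
  · exact isClosed_iInter fun a => isClosed_iInter fun b => isClosed_le (by fun_prop) (by fun_prop)
  · exact isClosed_eq (by fun_prop) (by fun_prop)

theorem convex_stateSet : Convex ℝ (stateSet Q) := by
  intro φ hφ ψ hψ s t hs ht hst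
  refine ⟨fun a b => ?_, fun c a => ?_, fun q hq => ?_, ?_⟩
  · simp [hφ.1, hψ.1]; ring
  · simp [hφ.2.1, hψ.2.1]; ring
  · have := hφ.2.2.1 q hq
    have := hψ.2.2.1 q hq
    simp only [Pi.add_apply, Pi.smul_apply, smul_eq_mul]; positivity
  · simp [hφ.2.2.2, hψ.2.2.2, hst]

theorem extreme_sq_mul (hQ : ArchQM Q) {L : MvPolynomial σ ℝ →ₗ[ℝ] ℝ}
    (hL : (L : MvPolynomial σ ℝ → ℝ) ∈ (stateSet Q).extremePoints ℝ)
    (a b : MvPolynomial σ ℝ) : L (a ^ 2 * b) = L (a ^ 2) * L b := by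
  have hS : IsState Q L := ⟨hL.1.2.2.1, hL.1.2.2.2⟩
  have ha := hS.1 _ (hQ.sq a)
  rcases ha.eq_or_lt with h0 | hpos
  · have := cauchy L (fun b => hS.1 _ (hQ.sq b)) a (a * b)
    rw [← h0, zero_mul] at this
    have e : a * (a * b) = a ^ 2 * b := by ring
    rw [e] at this
    rw [← h0, zero_mul]
    nlinarith
  obtain ⟨N₀, hN₀, hN₀m⟩ := hQ.bound_sq a
  set N := N₀ + 1 with hNdef
  have hN : 0 < N := by linarith
  have hNm : C N - a ^ 2 ∈ Q := by
    have := hQ.add _ hN₀m _ (hQ.const_mem (c := 1) zero_le_one)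
    convert this using 1
    rw [hNdef, C_add]; ring
  have hlt : L (a ^ 2) < N := by
    have := hS.1 _ hN₀m
    rw [map_sub, map_C hS.2] at this
    linarith
  set α := L (a ^ 2) with hα
  have h1 : (⇑(α⁻¹ • mulL L (a ^ 2)) : MvPolynomial σ ℝ → ℝ) ∈ stateSet Q := by
    apply coe_mem_stateSet
    refine ⟨fun q hq => ?_, ?_⟩
    · have := hS.1 _ (hQ.sq_mul a q hq)
      simp only [LinearMap.smul_apply, mulL_apply, smul_eq_mul]; positivity
    · simp only [LinearMap.smul_apply, mulL_apply, smul_eq_mul, mul_one]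
      rw [← hα]; field_simp
  have h2 : (⇑((N - α)⁻¹ • mulL L (C N - a ^ 2)) : MvPolynomial σ ℝ → ℝ) ∈ stateSet Q := by
    have hp : 0 < N - α := by linarith
    apply coe_mem_stateSet
    refine ⟨fun q hq => ?_, ?_⟩
    · have := hQ.key_bound hS hN hNm hq
      simp only [LinearMap.smul_apply, mulL_apply, smul_eq_mul]; positivity
    · simp only [LinearMap.smul_apply, mulL_apply, smul_eq_mul, mul_one]
      rw [map_sub, map_C hS.2, ← hα]; field_simp
  have hseg : (L : MvPolynomial σ ℝ → ℝ) ∈ openSegment ℝ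
      (⇑(α⁻¹ • mulL L (a ^ 2)) : MvPolynomial σ ℝ → ℝ) (⇑((N - α)⁻¹ • mulL L (C N - a ^ 2))) := by
    have hp : 0 < N - α := by linarith
    refine ⟨α / N, (N - α) / N, by positivity, by positivity, by field_simp; ring, ?_⟩
    funext c
    simp only [Pi.add_apply, Pi.smul_apply, LinearMap.smul_apply, mulL_apply, smul_eq_mul]
    rw [sub_mul, map_sub, ← smul_eq_C_mul, map_smul, smul_eq_mul]
    field_simp
    ring
  have := hL.2 h1 h2 hseg
  have := congrFun this b
  simp only [LinearMap.smul_apply, mulL_apply, smul_eq_mul] at this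
  rw [← this]; field_simp

theorem extreme_mul (hQ : ArchQM Q) {L : MvPolynomial σ ℝ →ₗ[ℝ] ℝ}
    (hL : (L : MvPolynomial σ ℝ → ℝ) ∈ (stateSet Q).extremePoints ℝ)
    (a b : MvPolynomial σ ℝ) : L (a * b) = L a * L b := by
  have h1 := hQ.extreme_sq_mul hL (a + 1) b
  have h2 := hQ.extreme_sq_mul hL a b
  have hone : L 1 = 1 := hL.1.2.2.2
  have e1 : (a + 1) ^ 2 * b = a ^ 2 * b + (2 : ℝ) • (a * b) + b := by
    rw [smul_eq_C_mul, show (C 2 : MvPolynomial σ ℝ) = 2 from rfl]; ring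
  have e2 : (a + 1) ^ 2 = a ^ 2 + (2 : ℝ) • a + 1 := by
    rw [smul_eq_C_mul, show (C 2 : MvPolynomial σ ℝ) = 2 from rfl]; ring
  rw [e1, e2] at h1
  simp only [map_add, map_smul, smul_eq_mul, hone] at h1
  linarith

/-- The positivity set of a quadratic module. -/
def pos (Q : Set (MvPolynomial σ ℝ)) : Set (σ → ℝ) := {x | ∀ q ∈ Q, 0 ≤ eval x q}

theorem extreme_eval (hQ : ArchQM Q) {L : MvPolynomial σ ℝ →ₗ[ℝ] ℝ}
    (hL : (L : MvPolynomial σ ℝ → ℝ) ∈ (stateSet Q).extremePoints ℝ) :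
    ∃ x ∈ pos Q, ∀ p, L p = eval x p := by
  have hone : L 1 = 1 := hL.1.2.2.2
  have h : ∀ p, L p = eval (fun i => L (X i)) p := by
    intro p
    have : AlgHom.ofLinearMap L hone (hQ.extreme_mul hL) = aeval (fun i => L (X i)) := by
      ext i; simp
    have := congrArg (fun g => g p) this
    simpa [aeval_eq_eval] using this
  exact ⟨fun i => L (X i), fun q hq => by rw [← h]; exact hL.1.2.2.1 q hq, h⟩

/-- A dual form of Putinar's Positivstellensatz. -/
theorem state_nonneg (hQ : ArchQM Q) {L : MvPolynomial σ ℝ →ₗ[ℝ] ℝ} (hL : IsState Q L)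
    {p : MvPolynomial σ ℝ} (hp : ∀ x ∈ pos Q, 0 ≤ eval x p) : 0 ≤ L p := by
  have hmem := coe_mem_stateSet hL
  rw [← closure_convexHull_extremePoints hQ.isCompact_stateSet convex_stateSet] at hmem
  have hcl : IsClosed {φ : MvPolynomial σ ℝ → ℝ | 0 ≤ φ p} :=
    isClosed_le (by fun_prop) (by fun_prop)
  have hcv : Convex ℝ {φ : MvPolynomial σ ℝ → ℝ | 0 ≤ φ p} := by
    intro φ hφ ψ hψ s t hs ht hst
    simp only [Set.mem_ofPred_eq] at hφ hψ
    simp only [Set.mem_ofPred_eq, Pi.add_apply, Pi.smul_apply, smul_eq_mul]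
    positivity
  refine closure_minimal (convexHull_min ?_ hcv) hcl hmem
  intro φ hφ
  obtain ⟨L', hL', rfl⟩ := exists_of_mem_stateSet hφ.1
  obtain ⟨x, hx, hLx⟩ := hQ.extreme_eval hφ
  simp only [Set.mem_ofPred_eq, hLx]
  exact hp x hx

/-- Existence of a separating state. -/
theorem exists_state (hQ : ArchQM Q) (D : MvPolynomial σ ℝ →ₗ[ℝ] MvPolynomial σ ℝ)
    (p : MvPolynomial σ ℝ) (hp : ∀ V, p - D V ∉ Q) :
    ∃ L : MvPolynomial σ ℝ →ₗ[ℝ] ℝ, IsState Q L ∧ (∀ V, L (D V) = 0) ∧ L p ≤ 0 := by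
  let S : PointedCone ℝ (MvPolynomial σ ℝ) :=
    { carrier := {a | ∃ q ∈ Q, ∃ V, ∃ t : ℝ, 0 ≤ t ∧ a = q + D V - t • p}
      zero_mem' := ⟨0, by simpa using hQ.const_mem le_rfl, 0, 0, le_rfl, by simp⟩
      add_mem' := by
        rintro _ _ ⟨q, hq, V, t, ht, rfl⟩ ⟨q', hq', V', t', ht', rfl⟩
        exact ⟨q + q', hQ.add _ hq _ hq', V + V', t + t', by positivity, by
          rw [map_add, add_smul]; ring⟩
      smul_mem' := by
        rintro ⟨c, hc⟩ _ ⟨q, hq, V, t, ht, rfl⟩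
        refine ⟨c • q, hQ.smul_mem hc hq, c • V, c * t, by positivity, ?_⟩
        change c • (q + D V - t • p) = _
        rw [map_smul, mul_smul, smul_sub, smul_add] }
  have hS : ∀ a, a ∈ S ↔ ∃ q ∈ Q, ∃ V, ∃ t : ℝ, 0 ≤ t ∧ a = q + D V - t • p := fun a => Iff.rfl
  have h1 : (1 : MvPolynomial σ ℝ) ≠ 0 := one_ne_zero
  let f : MvPolynomial σ ℝ →ₗ.[ℝ] ℝ := LinearPMap.mkSpanSingleton 1 (1 : ℝ) h1
  have hf : ∀ c : ℝ, ∀ h, f ⟨c • 1, h⟩ = c := by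
    intro c h
    exact (LinearPMap.mkSpanSingleton'_apply (1 : MvPolynomial σ ℝ) (1 : ℝ) _ c h).trans (by simp)
  obtain ⟨L, hL1, hL2⟩ := riesz_extension S f (by
    rintro ⟨x, hx⟩ hxS
    obtain ⟨c, rfl⟩ := Submodule.mem_span_singleton.1 hx
    rw [hf]
    by_contra hc
    push Not at hc
    obtain ⟨q, hq, V, t, ht, e⟩ := (hS _).1 hxS
    change c • (1 : MvPolynomial σ ℝ) = _ at e
    rcases ht.eq_or_lt with h0 | hpos
    · subst h0
      obtain ⟨N, hN⟩ := hQ.bound p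
      have hN' : C (|N|) + p ∈ Q := by
        have := hQ.add _ hN _ (hQ.const_mem (c := |N| - N) (by linarith [le_abs_self N]))
        convert this using 1
        rw [C_sub]; ring
      apply hp ((|N| / (-c)) • V)
      have hk : 0 ≤ |N| / (-c) := div_nonneg (abs_nonneg _) (by linarith)
      have := hQ.add _ hN' _ (hQ.smul_mem hk hq)
      convert this using 1
      have hq' : q = c • 1 - D V := by rw [e]; simp
      rw [hq', smul_sub, smul_smul, map_smul,
        show |N| / (-c) * c = - |N| by rw [div_neg, neg_mul, div_mul_cancel₀ _ hc.ne], smul_eq_C_mul (1 : MvPolynomial σ ℝ), C_neg]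
      ring
    · apply hp (t⁻¹ • V)
      have := hQ.add _ (hQ.smul_mem (inv_nonneg.2 ht) hq) _
        (hQ.const_mem (c := t⁻¹ * (-c)) (mul_nonneg (inv_nonneg.2 ht) (by linarith)))
      convert this using 1
      have hq' : q = c • 1 - D V + t • p := by rw [e]; ring
      rw [hq', smul_add, smul_sub, smul_smul, smul_smul, map_smul, inv_mul_cancel₀ hpos.ne',
        one_smul, smul_eq_C_mul (1 : MvPolynomial σ ℝ), mul_neg, C_neg]
      ring) (by
    intro y
    obtain ⟨N, hN⟩ := hQ.bound y
    refine ⟨⟨N • 1, Submodule.mem_span_singleton.2 ⟨N, rfl⟩⟩, (hS _).2 ⟨_, hN, 0, 0, le_rfl, ?_⟩⟩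
    simp [smul_eq_C_mul])
  refine ⟨L, ⟨fun q hq => hL2 _ ((hS _).2 ⟨q, hq, 0, 0, le_rfl, by simp⟩), ?_⟩, ?_, ?_⟩
  · have := hL1 ⟨(1 : ℝ) • 1, Submodule.mem_span_singleton.2 ⟨1, rfl⟩⟩
    have h2 := this.trans (hf 1 (Submodule.mem_span_singleton.2 ⟨1, rfl⟩))
    simpa using h2
  · have h0 : (0 : MvPolynomial σ ℝ) ∈ Q := by simpa using hQ.const_mem (σ := σ) le_rfl
    have hge : ∀ V, 0 ≤ L (D V) := fun V => hL2 _ ((hS _).2 ⟨0, h0, V, 0, le_rfl, by simp⟩)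
    intro V
    have := hge (-V)
    rw [map_neg, map_neg] at this
    linarith [hge V]
  · have h0 : (0 : MvPolynomial σ ℝ) ∈ Q := by simpa using hQ.const_mem (σ := σ) le_rfl
    have := hL2 _ ((hS _).2 ⟨0, h0, 0, 1, zero_le_one, rfl⟩)
    simp at this
    linarith

end ArchQM

namespace ArchQM
variable {σ : Type*} {Q : Set (MvPolynomial σ ℝ)}

theorem isClosed_pos : IsClosed (pos Q) := by
  have : pos Q = ⋂ q ∈ Q, {x | 0 ≤ eval x q} := by ext; simp [pos]
  rw [this]
  exact isClosed_iInter fun a => isClosed_iInter fun b =>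
    isClosed_le (by fun_prop) (MvPolynomial.continuous_eval a)

theorem exists_box [Finite σ] (hQ : ArchQM Q) : ∃ R : ℝ, 1 ≤ R ∧ ∀ x ∈ pos Q, ∀ i, |x i| ≤ R := by
  choose N hN using hQ.arch
  have := Fintype.ofFinite σ
  refine ⟨1 + ∑ i, |N i|, by
    have : 0 ≤ ∑ i, |N i| := Finset.sum_nonneg fun i _ => abs_nonneg _
    linarith, fun x hx i => ?_⟩
  have h1 := hx _ (hN i)
  simp only [map_sub, eval_C, map_pow, eval_X] at h1
  have h2 : |N i| ≤ ∑ i, |N i| :=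
    Finset.single_le_sum (f := fun i => |N i|) (fun i _ => abs_nonneg _) (Finset.mem_univ i)
  have h3 := le_abs_self (N i)
  apply abs_le_of_sq_le_sq _ (by linarith [abs_nonneg (N i)])
  nlinarith [abs_nonneg (N i)]

theorem isCompact_pos [Finite σ] (hQ : ArchQM Q) : IsCompact (pos Q) := by
  obtain ⟨R, -, hR⟩ := hQ.exists_box
  refine IsCompact.of_isClosed_subset (isCompact_univ_pi fun i => isCompact_Icc (a := -R) (b := R))
    isClosed_pos fun x hx i _ => abs_le.1 (hR x hx i)

theorem exists_measure [Finite σ] (hQ : ArchQM Q) {L : MvPolynomial σ ℝ →ₗ[ℝ] ℝ}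
    (hL : IsState Q L) : ∃ μ : Measure (σ → ℝ), IsProbabilityMeasure μ ∧ μ (pos Q)ᶜ = 0 ∧
      ∀ p, ∫ x, eval x p ∂μ = L p := by
  have := Fintype.ofFinite σ
  have hK : CompactSpace (pos Q) := isCompact_iff_compactSpace.1 hQ.isCompact_pos
  let e : MvPolynomial σ ℝ →ₗ[ℝ] C(pos Q, ℝ) :=
    { toFun := fun p => ⟨fun x => eval x.1 p, by
        exact (MvPolynomial.continuous_eval p).comp continuous_subtype_val⟩
      map_add' := fun p q => by ext; simp
      map_smul' := fun c p => by ext; simp }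
  have he : ∀ p x, e p x = eval x.1 p := fun p x => rfl
  have hker : LinearMap.ker e ≤ LinearMap.ker L := by
    intro p hp
    rw [LinearMap.mem_ker] at hp ⊢
    have h0 : ∀ x ∈ pos Q, eval x p = 0 := fun x hx => by rw [← he p ⟨x, hx⟩, hp]; rfl
    apply le_antisymm
    · have := hQ.state_nonneg hL (p := -p) (fun x hx => by rw [map_neg, h0 x hx, neg_zero])
      rw [map_neg] at this; linarith
    · exact hQ.state_nonneg hL (fun x hx => by rw [h0 x hx])
  let f : C(pos Q, ℝ) →ₗ.[ℝ] ℝ := ⟨LinearMap.range e,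
    ((LinearMap.ker e).liftQ L hker) ∘ₗ e.quotKerEquivRange.symm.toLinearMap⟩
  have hf : ∀ p h, f ⟨e p, h⟩ = L p := by
    intro p h
    change ((LinearMap.ker e).liftQ L hker) (e.quotKerEquivRange.symm ⟨e p, h⟩) = L p
    have := LinearMap.quotKerEquivRange_symm_apply_image e p h
    rw [this]; simp
  let S : PointedCone ℝ C(pos Q, ℝ) :=
    { carrier := {φ | 0 ≤ φ}
      zero_mem' := le_refl (0 : C(pos Q, ℝ))
      add_mem' := fun {a b} ha hb => add_nonneg (a := a) (b := b) ha hb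
      smul_mem' := fun c x hx => smul_nonneg (α := ℝ) (β := C(pos Q, ℝ)) c.2 hx }
  have hS : ∀ φ, φ ∈ S ↔ 0 ≤ φ := fun _ => Iff.rfl
  obtain ⟨Λ, hΛ1, hΛ2⟩ := riesz_extension S f (by
    rintro ⟨_, p, rfl⟩ hp
    refine le_of_le_of_eq ?_ (hf p _).symm
    exact hQ.state_nonneg hL fun x hx => (hS _).1 hp ⟨x, hx⟩) (by
    intro φ
    refine ⟨⟨e (C ‖φ‖), ⟨_, rfl⟩⟩, (hS _).2 fun x => ?_⟩
    have := φ.norm_coe_le_norm x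
    rw [Real.norm_eq_abs, abs_le] at this
    have h2 : e (C ‖φ‖) x = ‖φ‖ := by rw [he, eval_C]
    change 0 ≤ e (C ‖φ‖) x + φ x
    linarith)
  have hΛe : ∀ p, Λ (e p) = L p := fun p => (hΛ1 ⟨e p, ⟨p, rfl⟩⟩).trans (hf p _)
  let Λ₀ : CompactlySupportedContinuousMap (pos Q) ℝ →ₗ[ℝ] ℝ :=
    { toFun := fun φ => Λ φ.toContinuousMap
      map_add' := fun a b => by rw [← map_add]; rfl
      map_smul' := fun c a => by rw [RingHom.id_apply, ← map_smul]; rfl }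
  let Λ' : CompactlySupportedContinuousMap (pos Q) ℝ →ₚ[ℝ] ℝ :=
    PositiveLinearMap.mk₀ Λ₀ (fun φ hφ => hΛ2 _ ((hS _).2 fun x => hφ x))
  let ν := RealRMK.rieszMeasure Λ'
  have hν : ∀ p, ∫ x, eval x.1 p ∂ν = L p := by
    intro p
    have := RealRMK.integral_rieszMeasure Λ'
      (CompactlySupportedContinuousMap.continuousMapEquiv (e p))
    refine this.trans ?_
    exact hΛe p
  have hfin : IsFiniteMeasure ν := by infer_instance
  have hprob : IsProbabilityMeasure ν := by
    have h1 := hν 1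
    simp only [map_one, hL.2, integral_const, smul_eq_mul, mul_one] at h1
    constructor
    rw [measureReal_def] at h1
    rwa [ENNReal.toReal_eq_one_iff] at h1
  have hmeas : Measurable (Subtype.val : pos Q → (σ → ℝ)) := measurable_subtype_coe
  refine ⟨ν.map Subtype.val, Measure.isProbabilityMeasure_map hmeas.aemeasurable, ?_, fun p => ?_⟩
  · rw [Measure.map_apply hmeas isClosed_pos.measurableSet.compl]
    convert measure_empty (μ := ν)
    ext x; simp
  · rw [integral_map hmeas.aemeasurable (MvPolynomial.continuous_eval p).aestronglyMeasurable]
    exact hν p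

/-- Two finite measures on a compact set with the same moments agree. -/
theorem measure_ext_moments [Finite σ] {μ ν : Measure (σ → ℝ)} [IsProbabilityMeasure μ]
    [IsProbabilityMeasure ν]
    {K : Set (σ → ℝ)} (hK : IsCompact K) (hμ : ∀ᵐ x ∂μ, x ∈ K) (hν : ∀ᵐ x ∂ν, x ∈ K)
    (h : ∀ p : MvPolynomial σ ℝ, ∫ x, eval x p ∂μ = ∫ x, eval x p ∂ν) : μ = ν := by
  have := Fintype.ofFinite σ
  apply ext_of_forall_integral_eq_of_IsFiniteMeasure
  intro F
  let e : MvPolynomial σ ℝ →ₐ[ℝ] C(σ → ℝ, ℝ) := aeval (fun i => ⟨fun x => x i, by fun_prop⟩)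
  have he : ∀ p x, e p x = eval x p := by
    intro p x
    have : (ContinuousMap.evalAlgHom ℝ ℝ x).comp e = aeval x := by
      ext i; simp [e]
    have := congrArg (fun g => g p) this
    simpa [aeval_eq_eval] using this
  have hsep : e.range.SeparatesPoints := by
    intro x y hxy
    obtain ⟨i, hi⟩ := Function.ne_iff.1 hxy
    exact ⟨_, ⟨e (X i), ⟨X i, rfl⟩, rfl⟩, by simpa [he] using hi⟩
  have key : ∀ ε : ℝ, 0 < ε → |∫ x, F x ∂μ - ∫ x, F x ∂ν| ≤ 2 * ε := by
    intro ε hε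
    obtain ⟨_, ⟨p, rfl⟩, hp⟩ :=
      ContinuousMap.exists_mem_subalgebra_near_continuous_of_isCompact_of_separatesPoints
      hsep F.toContinuousMap hK hε
    have hp' : ∀ x ∈ K, ‖F x - eval x p‖ ≤ ε := fun x hx => by
      have := (hp x hx).le
      rw [norm_sub_rev]
      simpa [he] using this
    obtain ⟨Cb, hCb⟩ := hK.exists_bound_of_continuousOn (MvPolynomial.continuous_eval p).continuousOn
    have one : ∀ (m : Measure (σ → ℝ)) [IsProbabilityMeasure m], (∀ᵐ x ∂m, x ∈ K) →
        |∫ x, F x ∂m - ∫ x, eval x p ∂m| ≤ ε := by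
      intro m _ hm
      have hi : Integrable (fun x => eval x p) m :=
        Integrable.of_bound (MvPolynomial.continuous_eval p).aestronglyMeasurable Cb
          (by filter_upwards [hm] with x hx using hCb x hx)
      rw [← integral_sub (F.integrable m) hi, ← Real.norm_eq_abs]
      have := norm_integral_le_of_norm_le_const (μ := m) (f := fun x => F x - eval x p) (C := ε)
        (by filter_upwards [hm] with x hx using hp' x hx)
      simpa using this
    have h1 := one μ hμ
    have h2 := one ν hν
    rw [h p] at h1
    rw [abs_le] at *
    constructor <;> linarith
  have h0 : |∫ x, F x ∂μ - ∫ x, F x ∂ν| ≤ 0 := by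
    apply le_of_forall_pos_le_add
    intro ε hε
    have := key (ε / 2) (by linarith)
    linarith
  exact sub_eq_zero.1 (abs_nonpos_iff.1 h0)

end ArchQM

namespace PolyFlow
variable {σ : Type*}

/-- weighted `ℓ¹` norm of a polynomial -/
noncomputable def nrm (R : ℝ) (p : MvPolynomial σ ℝ) : ℝ :=
  ∑ s ∈ p.support, |p.coeff s| * R ^ s.degree

theorem nrm_eq_of_subset {R : ℝ} {p : MvPolynomial σ ℝ} {t : Finset (σ →₀ ℕ)}
    (h : p.support ⊆ t) : nrm R p = ∑ s ∈ t, |p.coeff s| * R ^ s.degree := by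
  unfold nrm
  apply Finset.sum_subset h
  intro s _ hs
  rw [MvPolynomial.notMem_support_iff.1 hs]; simp

theorem nrm_nonneg {R : ℝ} (hR : 0 ≤ R) (p : MvPolynomial σ ℝ) : 0 ≤ nrm R p :=
  Finset.sum_nonneg fun s _ => by positivity

theorem nrm_zero {R : ℝ} : nrm R (0 : MvPolynomial σ ℝ) = 0 := by simp [nrm]

theorem nrm_add_le {R : ℝ} (hR : 0 ≤ R) (p q : MvPolynomial σ ℝ) :
    nrm R (p + q) ≤ nrm R p + nrm R q := by
  classical
  rw [nrm_eq_of_subset (t := p.support ∪ q.support) MvPolynomial.support_add,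
    nrm_eq_of_subset (p := p) (t := p.support ∪ q.support) Finset.subset_union_left,
    nrm_eq_of_subset (p := q) (t := p.support ∪ q.support) Finset.subset_union_right,
    ← Finset.sum_add_distrib]
  apply Finset.sum_le_sum
  intro s _
  rw [coeff_add, ← add_mul]
  exact mul_le_mul_of_nonneg_right (abs_add_le _ _) (by positivity)

theorem nrm_sum_le {ι : Type*} {R : ℝ} (hR : 0 ≤ R) (t : Finset ι) (p : ι → MvPolynomial σ ℝ) :
    nrm R (∑ i ∈ t, p i) ≤ ∑ i ∈ t, nrm R (p i) := by
  classical
  induction t using Finset.induction_on with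
  | empty => simp [nrm_zero]
  | insert a t ha ih =>
    rw [Finset.sum_insert ha, Finset.sum_insert ha]
    exact (nrm_add_le hR _ _).trans (by linarith)

theorem nrm_monomial {R : ℝ} (s : σ →₀ ℕ) (a : ℝ) :
    nrm R (monomial s a) = |a| * R ^ s.degree := by
  classical
  rw [nrm_eq_of_subset (t := {s}) MvPolynomial.support_monomial_subset]
  simp

theorem nrm_mul_le {R : ℝ} (hR : 0 ≤ R) (p q : MvPolynomial σ ℝ) :
    nrm R (p * q) ≤ nrm R p * nrm R q := by
  conv_lhs => rw [← p.support_sum_monomial_coeff, ← q.support_sum_monomial_coeff,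
    Finset.sum_mul_sum]
  unfold nrm
  rw [Finset.sum_mul_sum]
  refine (nrm_sum_le hR _ _).trans (Finset.sum_le_sum fun s _ => ?_)
  refine (nrm_sum_le hR _ _).trans (Finset.sum_le_sum fun t _ => ?_)
  rw [monomial_mul, nrm_monomial, abs_mul, map_add, pow_add]
  apply le_of_eq; ring

theorem abs_eval_le {R : ℝ} (p : MvPolynomial σ ℝ) {x : σ → ℝ}
    (hx : ∀ i, |x i| ≤ R) : |eval x p| ≤ nrm R p := by
  rw [eval_eq]
  refine (Finset.abs_sum_le_sum_abs _ _).trans (Finset.sum_le_sum fun s _ => ?_)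
  rw [abs_mul, Finset.abs_prod, Finsupp.degree_apply, ← Finset.prod_pow_eq_pow_sum]
  refine mul_le_mul_of_nonneg_left ?_ (abs_nonneg _)
  refine Finset.prod_le_prod (fun i _ => abs_nonneg _) fun i _ => ?_
  rw [abs_pow]
  exact pow_le_pow_left₀ (abs_nonneg _) (hx i) _

theorem degree_sub_le (s : σ →₀ ℕ) (i : σ) :
    (s - Finsupp.single i 1).degree ≤ s.degree := Finsupp.degree_mono tsub_le_self

theorem nrm_pderiv_le {R : ℝ} (hR : 1 ≤ R) (i : σ) (p : MvPolynomial σ ℝ) :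
    nrm R (pderiv i p) ≤ p.totalDegree * nrm R p := by
  have hR0 : 0 ≤ R := by linarith
  conv_lhs => rw [← p.support_sum_monomial_coeff, map_sum]
  refine (nrm_sum_le hR0 _ _).trans ?_
  rw [nrm, Finset.mul_sum]
  refine Finset.sum_le_sum fun s hs => ?_
  rw [pderiv_monomial, nrm_monomial, abs_mul, Nat.abs_cast]
  have h1 : (s i : ℝ) ≤ p.totalDegree := by
    have h2 : s.degree ≤ p.totalDegree := le_totalDegree hs
    have h3 : s i ≤ s.degree := Finsupp.le_degree i s
    exact_mod_cast h3.trans h2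
  have h4 : R ^ (s - Finsupp.single i 1).degree ≤ R ^ s.degree :=
    pow_le_pow_right₀ hR (degree_sub_le s i)
  calc |coeff s p| * (s i : ℝ) * R ^ (s - Finsupp.single i 1).degree
      ≤ |coeff s p| * p.totalDegree * R ^ s.degree := by gcongr
    _ = _ := by ring

theorem totalDegree_pderiv_le (i : σ) (p : MvPolynomial σ ℝ) :
    (pderiv i p).totalDegree ≤ p.totalDegree := by
  conv_lhs => rw [← p.support_sum_monomial_coeff, map_sum]
  refine totalDegree_finsetSum_le fun s hs => ?_
  rw [pderiv_monomial]
  refine (totalDegree_monomial_le _ _).trans ?_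
  exact (degree_sub_le s i).trans (le_totalDegree hs)

variable [Fintype σ] (W : σ → MvPolynomial σ ℝ)

/-- Lie derivative along the polynomial vector field `W`. -/
noncomputable def lie : Derivation ℝ (MvPolynomial σ ℝ) (MvPolynomial σ ℝ) := mkDerivation ℝ W

theorem lie_X (i : σ) : lie W (X i) = W i := mkDerivation_X _ _ _

theorem derivation_sum_apply {ι : Type*} (t : Finset ι)
    (D : ι → Derivation ℝ (MvPolynomial σ ℝ) (MvPolynomial σ ℝ)) (p : MvPolynomial σ ℝ) :
    (∑ i ∈ t, D i) p = ∑ i ∈ t, D i p := by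
  classical
  induction t using Finset.induction_on with
  | empty => simp
  | insert a t ha ih => rw [Finset.sum_insert ha, Finset.sum_insert ha, Derivation.add_apply, ih]

theorem lie_eq (p : MvPolynomial σ ℝ) : lie W p = ∑ i, W i * pderiv i p := by
  classical
  have : lie W = ∑ i, W i • pderiv (R := ℝ) i := by
    apply derivation_ext
    intro j
    rw [lie_X, derivation_sum_apply]
    simp [pderiv_X, Pi.single_apply]
  rw [this, derivation_sum_apply]
  rfl

/-- iterates of the Lie derivative -/
noncomputable def it (k : ℕ) (p : MvPolynomial σ ℝ) : MvPolynomial σ ℝ := (lie W)^[k] p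

theorem it_zero (p : MvPolynomial σ ℝ) : it W 0 p = p := rfl
theorem it_succ (k : ℕ) (p : MvPolynomial σ ℝ) : it W (k+1) p = lie W (it W k p) :=
  Function.iterate_succ_apply' _ _ _
theorem it_succ' (k : ℕ) (p : MvPolynomial σ ℝ) : it W (k+1) p = it W k (lie W p) :=
  Function.iterate_succ_apply _ _ _

theorem it_add (k : ℕ) (p q : MvPolynomial σ ℝ) : it W k (p + q) = it W k p + it W k q := by
  induction k with
  | zero => rfl
  | succ k ih => rw [it_succ, ih, map_add, ← it_succ, ← it_succ]

theorem it_smul (k : ℕ) (c : ℝ) (p : MvPolynomial σ ℝ) : it W k (c • p) = c • it W k p := by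
  induction k with
  | zero => rfl
  | succ k ih => rw [it_succ, ih, Derivation.map_smul, ← it_succ]

theorem it_one (k : ℕ) : it W (k+1) 1 = 0 := by
  rw [it_succ', Derivation.map_one_eq_zero]
  have := it_smul W k 0 0
  simpa using this

/-- Uniform factorial growth bound of iterated Lie derivatives. -/
theorem exists_growth {R : ℝ} (hR : 1 ≤ R) : ∃ A : ℝ, 0 < A ∧ ∀ p : MvPolynomial σ ℝ,
    ∃ c : ℝ, 0 ≤ c ∧ ∀ k, ∀ x : σ → ℝ, (∀ i, |x i| ≤ R) →
      |eval x (it W k p)| ≤ c * A ^ k * k.factorial := by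
  have hR0 : 0 ≤ R := by linarith
  set m : ℕ := (∑ i, (W i).totalDegree) + 1 with hm
  set b : ℝ := (∑ i, nrm R (W i)) + 1 with hb
  have hb0 : 0 < b := by
    have : 0 ≤ ∑ i, nrm R (W i) := Finset.sum_nonneg fun i _ => nrm_nonneg hR0 _
    linarith
  have hdeg : ∀ p, (lie W p).totalDegree ≤ p.totalDegree + m := by
    intro p
    rw [lie_eq]
    refine totalDegree_finsetSum_le fun i _ => ?_
    refine (totalDegree_mul _ _).trans ?_
    have h1 := totalDegree_pderiv_le i p
    have h2 : (W i).totalDegree ≤ ∑ i, (W i).totalDegree :=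
      Finset.single_le_sum (f := fun i => (W i).totalDegree) (fun _ _ => Nat.zero_le _)
        (Finset.mem_univ i)
    omega
  have hnrm : ∀ p, nrm R (lie W p) ≤ b * (p.totalDegree * nrm R p) := by
    intro p
    rw [lie_eq]
    have h0 : 0 ≤ (p.totalDegree : ℝ) * nrm R p := mul_nonneg (Nat.cast_nonneg _) (nrm_nonneg hR0 _)
    calc nrm R (∑ i, W i * pderiv i p) ≤ ∑ i, nrm R (W i) * (p.totalDegree * nrm R p) := by
          refine (nrm_sum_le hR0 _ _).trans (Finset.sum_le_sum fun i _ => ?_)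
          refine (nrm_mul_le hR0 _ _).trans ?_
          exact mul_le_mul_of_nonneg_left (nrm_pderiv_le hR i p) (nrm_nonneg hR0 _)
      _ = (∑ i, nrm R (W i)) * (p.totalDegree * nrm R p) := by rw [Finset.sum_mul]
      _ ≤ _ := mul_le_mul_of_nonneg_right (by linarith) h0
  refine ⟨2 * (b * m), by positivity, fun p => ?_⟩
  set d := p.totalDegree with hd
  have hdk : ∀ k, (it W k p).totalDegree ≤ d + m * k := by
    intro k
    induction k with
    | zero => simp [it_zero, hd]
    | succ k ih => rw [it_succ]; refine (hdeg _).trans ?_; rw [mul_add]; omega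
  have hnk : ∀ k, nrm R (it W k p) * d.factorial ≤ nrm R p * (b * m) ^ k * (d + k).factorial := by
    intro k
    induction k with
    | zero => simp [it_zero]
    | succ k ih =>
      rw [it_succ]
      have h1 : ((it W k p).totalDegree : ℝ) ≤ m * (d + k + 1) := by
        have : (it W k p).totalDegree ≤ m * (d + k + 1) := by
          have h2 : 1 ≤ m := by omega
          nlinarith [hdk k, Nat.zero_le d, Nat.zero_le k]
        exact_mod_cast this
      calc nrm R (lie W (it W k p)) * d.factorial
          ≤ b * ((m * (d + k + 1)) * nrm R (it W k p)) * d.factorial := by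
            refine mul_le_mul_of_nonneg_right ((hnrm _).trans ?_) (by positivity)
            refine mul_le_mul_of_nonneg_left ?_ hb0.le
            exact mul_le_mul_of_nonneg_right h1 (nrm_nonneg hR0 _)
        _ = (b * m) * (d + k + 1) * (nrm R (it W k p) * d.factorial) := by ring
        _ ≤ (b * m) * (d + k + 1) * (nrm R p * (b * m) ^ k * (d + k).factorial) := by
            refine mul_le_mul_of_nonneg_left ih (by positivity)
        _ = _ := by
            rw [← add_assoc, Nat.factorial_succ]; push_cast; ring
  refine ⟨nrm R p * 2 ^ d, mul_nonneg (nrm_nonneg hR0 _) (by positivity), fun k x hx => ?_⟩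
  refine (abs_eval_le _ hx).trans ?_
  have h3 : ((d + k).factorial : ℝ) ≤ 2 ^ (d + k) * d.factorial * k.factorial := by
    have h4 := Nat.add_choose_mul_factorial_mul_factorial d k
    have h5 : (d + k).choose k ≤ 2 ^ (d + k) := Nat.choose_le_two_pow _ _
    have : (d + k).factorial ≤ 2 ^ (d + k) * d.factorial * k.factorial := by
      rw [← h4]; gcongr
    exact_mod_cast this
  have hdf : (0 : ℝ) < d.factorial := by positivity
  have h0 : 0 ≤ nrm R p * (b * m) ^ k := mul_nonneg (nrm_nonneg hR0 _) (by positivity)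
  have h6 : nrm R (it W k p) * d.factorial ≤
      (nrm R p * 2 ^ d * (2 * (b * m)) ^ k * k.factorial) * d.factorial := by
    refine (hnk k).trans ((mul_le_mul_of_nonneg_left h3 h0).trans (le_of_eq ?_))
    rw [mul_pow 2, pow_add]; ring
  exact le_of_mul_le_mul_right h6 hdf

end PolyFlow

namespace PolyFlow

/-- exponential generating function of a sequence -/
noncomputable def Egf (b : ℕ → ℝ) (t : ℝ) : ℝ := ∑' k, t ^ k / k.factorial * b k

theorem egf_term_le {b : ℕ → ℝ} {c A : ℝ} (hb : ∀ k, |b k| ≤ c * A ^ k * k.factorial) (t : ℝ)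
    (k : ℕ) : ‖t ^ k / k.factorial * b k‖ ≤ c * (|t| * A) ^ k := by
  have hk : (0:ℝ) < k.factorial := by positivity
  rw [Real.norm_eq_abs, abs_mul, abs_div, abs_pow, Nat.abs_cast]
  calc |t| ^ k / k.factorial * |b k| ≤ |t| ^ k / k.factorial * (c * A ^ k * k.factorial) := by
        gcongr; exact hb k
    _ = _ := by rw [mul_pow]; field_simp

theorem egf_geom {c A t : ℝ} (hA : 0 < A) (ht : |t| * A < 1) :
    Summable fun k : ℕ => c * (|t| * A) ^ k :=
  (summable_geometric_of_lt_one (by positivity) ht).mul_left c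

theorem egf_summable {b : ℕ → ℝ} {c A : ℝ} (hA : 0 < A)
    (hb : ∀ k, |b k| ≤ c * A ^ k * k.factorial) {t : ℝ} (ht : |t| * A < 1) :
    Summable fun k => ‖t ^ k / k.factorial * b k‖ :=
  Summable.of_nonneg_of_le (fun _ => norm_nonneg _) (egf_term_le hb t) (egf_geom hA ht)

theorem egf_zero (b : ℕ → ℝ) : Egf b 0 = b 0 := by
  unfold Egf
  rw [tsum_eq_single 0]
  · simp
  · intro k hk; simp [hk]

theorem egf_hasDerivAt {b : ℕ → ℝ} {c A : ℝ} (hA : 0 < A)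
    (hb : ∀ k, |b k| ≤ c * A ^ k * k.factorial) {t : ℝ} (ht : |t| * A < 1) :
    HasDerivAt (Egf b) (Egf (fun k => b (k+1)) t) t := by
  obtain ⟨r, htr, hr⟩ : ∃ r, |t| < r ∧ r < 1 / A := exists_between (by rwa [lt_div_iff₀ hA])
  have hr0 : 0 < r := (abs_nonneg t).trans_lt htr
  have hrA : r * A < 1 := by rwa [lt_div_iff₀ hA] at hr
  set g' : ℕ → ℝ → ℝ := fun k y => (k * y ^ (k-1)) / k.factorial * b k with hg'
  have hc : 0 ≤ c := by simpa using (abs_nonneg _).trans (hb 0)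
  have hu : Summable fun k : ℕ => (c / r) * ((k:ℝ) ^ 1 * (r * A) ^ k) := by
    apply Summable.mul_left
    apply summable_pow_mul_geometric_of_norm_lt_one
    rw [Real.norm_eq_abs, abs_of_pos (by positivity)]; exact hrA
  have hbd : ∀ k, ∀ y ∈ Metric.ball (0:ℝ) r, ‖g' k y‖ ≤ (c / r) * ((k:ℝ) ^ 1 * (r * A) ^ k) := by
    intro k y hy
    have hy' : |y| ≤ r := by simpa using (mem_ball_zero_iff.1 hy).le
    rcases Nat.eq_zero_or_pos k with rfl | hk
    · simp [hg']
    have hkf : (0:ℝ) < k.factorial := by positivity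
    rw [hg', Real.norm_eq_abs, abs_mul, abs_div, abs_mul, abs_pow, Nat.abs_cast, Nat.abs_cast]
    calc (k * |y| ^ (k-1)) / k.factorial * |b k|
        ≤ (k * r ^ (k-1)) / k.factorial * (c * A ^ k * k.factorial) := by
          gcongr; exact hb k
      _ = _ := by
          obtain ⟨m, rfl⟩ : ∃ m, k = m + 1 := ⟨k-1, by omega⟩
          rw [mul_pow, Nat.add_sub_cancel, pow_succ r, pow_one]; field_simp
  have h := hasDerivAt_tsum_of_isPreconnected (g := fun k y => y ^ k / k.factorial * b k) (g' := g')
    (t := Metric.ball (0:ℝ) r) (y₀ := 0) (y := t) hu Metric.isOpen_ball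
    (convex_ball (0:ℝ) r).isPreconnected
    (fun k y _ => by
      have := ((hasDerivAt_pow k y).div_const (k.factorial : ℝ)).mul_const (b k)
      simpa [hg'] using this) hbd (by simpa using hr0)
    (by
      have := egf_summable (t := 0) hA hb (by simp)
      exact this.of_norm) (by simpa using htr)
  have hs : Summable fun k => g' k t :=
    Summable.of_norm_bounded hu (fun k => hbd k t (by simpa using htr))
  have he : ∑' k, g' k t = Egf (fun k => b (k+1)) t := by
    rw [hs.tsum_eq_zero_add]
    simp only [hg', Egf, CharP.cast_eq_zero, zero_mul, zero_div, zero_add]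
    congr 1; ext k
    rw [Nat.factorial_succ]
    push_cast
    have : (k.factorial : ℝ) ≠ 0 := by positivity
    field_simp
  rw [← he]
  exact h

variable {σ : Type*} [Fintype σ] (W : σ → MvPolynomial σ ℝ)

theorem it_leibniz (n : ℕ) (p q : MvPolynomial σ ℝ) : it W n (p * q) =
    ∑ ij ∈ Finset.HasAntidiagonal.antidiagonal n, n.choose ij.1 • (it W ij.1 p * it W ij.2 q) := by
  induction n with
  | zero => simp [it_zero]
  | succ n ih =>
    rw [it_succ, ih, map_sum, Finset.sum_antidiagonal_choose_succ_nsmul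
      (fun i j => it W i p * it W j q), ← Finset.sum_add_distrib]
    refine Finset.sum_congr rfl fun ij hij => ?_
    have h : n.choose ij.2 = n.choose ij.1 := by
      rw [Finset.HasAntidiagonal.mem_antidiagonal] at hij
      rw [← hij]; exact (Nat.choose_symm_add).symm
    rw [h, ← smul_add, map_nsmul, Derivation.leibniz, it_succ, it_succ, smul_eq_mul, smul_eq_mul,
      mul_comm (it W ij.2 q)]

/-- formal flow acting on polynomials -/
noncomputable def S (x : σ → ℝ) (t : ℝ) (p : MvPolynomial σ ℝ) : ℝ :=
  Egf (fun k => eval x (it W k p)) t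

theorem S_C {x : σ → ℝ} {t : ℝ} (a : ℝ) : S W x t (C a) = a := by
  unfold S Egf
  rw [tsum_eq_single 0]
  · simp [it_zero]
  · intro k hk
    obtain ⟨m, rfl⟩ : ∃ m, k = m + 1 := ⟨k-1, by omega⟩
    have : (C a : MvPolynomial σ ℝ) = a • 1 := by rw [smul_eq_C_mul, mul_one]
    beta_reduce; rw [this, it_smul, it_one]; simp

/-- growth condition with rate `A` on the box of radius `R` -/
def Growth (R A : ℝ) : Prop := 0 < A ∧ ∀ p : MvPolynomial σ ℝ,
    ∃ c : ℝ, 0 ≤ c ∧ ∀ k, ∀ x : σ → ℝ, (∀ i, |x i| ≤ R) →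
      |eval x (it W k p)| ≤ c * A ^ k * k.factorial

variable {W} {R A : ℝ} (hG : Growth W R A) {x : σ → ℝ} (hx : ∀ i, |x i| ≤ R) {t : ℝ}
  (ht : |t| * A < 1)
include hG hx ht

theorem S_mul (p q : MvPolynomial σ ℝ) : S W x t (p * q) = S W x t p * S W x t q := by
  obtain ⟨c1, _, h1⟩ := hG.2 p
  obtain ⟨c2, _, h2⟩ := hG.2 q
  have s1 := egf_summable hG.1 (fun k => h1 k x hx) ht
  have s2 := egf_summable hG.1 (fun k => h2 k x hx) ht
  unfold S Egf
  rw [tsum_mul_tsum_eq_tsum_sum_antidiagonal_of_summable_norm s1 s2]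
  congr 1; ext n; beta_reduce
  rw [it_leibniz, map_sum, Finset.mul_sum]
  refine Finset.sum_congr rfl fun ij hij => ?_
  rw [Finset.HasAntidiagonal.mem_antidiagonal] at hij
  have h3 := Nat.add_choose_mul_factorial_mul_factorial ij.1 ij.2
  rw [map_nsmul, map_mul, nsmul_eq_mul]
  subst hij
  have h3' : ((ij.1 + ij.2).choose ij.1 : ℝ) * ij.1.factorial * ij.2.factorial =
      (ij.1 + ij.2).factorial := by
    rw [Nat.choose_symm_add]
    exact_mod_cast h3
  have e1 : (ij.1.factorial : ℝ) ≠ 0 := by positivity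
  have e2 : (ij.2.factorial : ℝ) ≠ 0 := by positivity
  have e3 : ((ij.1 + ij.2).factorial : ℝ) ≠ 0 := by positivity
  rw [pow_add]
  field_simp
  rw [← h3']; ring

theorem S_add (p q : MvPolynomial σ ℝ) : S W x t (p + q) = S W x t p + S W x t q := by
  obtain ⟨c1, _, h1⟩ := hG.2 p
  obtain ⟨c2, _, h2⟩ := hG.2 q
  have s1 := (egf_summable hG.1 (fun k => h1 k x hx) ht).of_norm
  have s2 := (egf_summable hG.1 (fun k => h2 k x hx) ht).of_norm
  unfold S Egf
  rw [← s1.tsum_add s2]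
  congr 1; ext n; beta_reduce
  rw [it_add, map_add, mul_add]

theorem S_eq_eval (p : MvPolynomial σ ℝ) : S W x t p = eval (fun i => S W x t (X i)) p := by
  induction p using MvPolynomial.induction_on with
  | C a => rw [S_C W, eval_C]
  | add p q hp hq => rw [S_add hG hx ht, hp, hq, map_add]
  | mul_X p i hp => rw [S_mul hG hx ht, hp, map_mul, eval_X]

theorem S_hasDerivAt (p : MvPolynomial σ ℝ) :
    HasDerivAt (fun t => S W x t p) (S W x t (lie W p)) t := by
  obtain ⟨c1, _, h1⟩ := hG.2 p
  have := egf_hasDerivAt hG.1 (fun k => h1 k x hx) ht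
  simpa only [S, it_succ'] using this

end PolyFlow

namespace PolyFlow
variable {σ : Type*} [Fintype σ]

/-- the closed box -/
def box (σ : Type*) (R : ℝ) : Set (σ → ℝ) := {x | ∀ i, |x i| ≤ R}

theorem series_cont {P : ℕ → MvPolynomial σ ℝ} {R A c t : ℝ} (hA : 0 < A)
    (hP : ∀ k, ∀ x ∈ box σ R, |eval x (P k)| ≤ c * A ^ k * k.factorial) (ht : |t| * A < 1) :
    ContinuousOn (fun x => Egf (fun k => eval x (P k)) t) (box σ R) := by
  unfold Egf
  refine continuousOn_tsum (u := fun k => c * (|t| * A) ^ k) (fun k => ?_) (egf_geom hA ht) ?_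
  · exact ((MvPolynomial.continuous_eval (P k)).const_mul _).continuousOn
  · intro k x hx
    exact egf_term_le (fun k => hP k x hx) t k

theorem series_integral {P : ℕ → MvPolynomial σ ℝ} {R A c t : ℝ} (hA : 0 < A)
    (hP : ∀ k, ∀ x ∈ box σ R, |eval x (P k)| ≤ c * A ^ k * k.factorial) (ht : |t| * A < 1)
    (μ : Measure (σ → ℝ)) [IsProbabilityMeasure μ] (hμ : ∀ᵐ x ∂μ, x ∈ box σ R) :
    ∫ x, Egf (fun k => eval x (P k)) t ∂μ = Egf (fun k => ∫ x, eval x (P k) ∂μ) t := by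
  have hb : ∀ k, ∀ᵐ x ∂μ, ‖t ^ k / k.factorial * eval x (P k)‖ ≤ c * (|t| * A) ^ k := by
    intro k
    filter_upwards [hμ] with x hx
    exact egf_term_le (fun k => hP k x hx) t k
  have hi : ∀ k, Integrable (fun x => t ^ k / k.factorial * eval x (P k)) μ := by
    intro k
    refine Integrable.mono' (integrable_const (c * (|t| * A) ^ k)) ?_ (hb k)
    exact ((MvPolynomial.continuous_eval (P k)).const_mul _).aestronglyMeasurable
  have hs : Summable fun k => ∫ x, ‖t ^ k / k.factorial * eval x (P k)‖ ∂μ := by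
    refine Summable.of_nonneg_of_le (fun k => integral_nonneg fun _ => norm_nonneg _) (fun k => ?_)
      (egf_geom (c := c) hA ht)
    have := integral_mono_ae (hi k).norm (integrable_const (c * (|t| * A) ^ k)) (hb k)
    simpa using this
  have := hasSum_integral_of_summable_integral_norm hi hs
  unfold Egf
  rw [← this.tsum_eq]
  congr 1; ext k
  exact integral_const_mul _ _

/-- The local flow of a polynomial vector field, uniformly on a box. -/
theorem exists_flow (W : σ → MvPolynomial σ ℝ) (Φ : MvPolynomial σ ℝ) {R : ℝ} (hR : 1 ≤ R) :
    ∃ τ : ℝ, 0 < τ ∧ ∃ (c : (σ → ℝ) → ℝ → (σ → ℝ)) (a : (σ → ℝ) → ℝ → ℝ),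
      (∀ x, c x 0 = x) ∧ (∀ x, a x 0 = 0) ∧
      (∀ x ∈ box σ R, ∀ t ∈ Set.Icc 0 τ, HasDerivAt (c x) (fun i => eval (c x t) (W i)) t) ∧
      (∀ x ∈ box σ R, ∀ t ∈ Set.Icc 0 τ, HasDerivAt (a x) (eval (c x t) Φ) t) ∧
      ContinuousOn (fun x => c x τ) (box σ R) ∧ ContinuousOn (fun x => a x τ) (box σ R) ∧
      ∀ μ : Measure (σ → ℝ), IsProbabilityMeasure μ → (∀ᵐ x ∂μ, x ∈ box σ R) →
        (∀ p, ∫ x, eval x (lie W p) ∂μ = 0) →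
        (∀ p, ∫ x, eval (c x τ) p ∂μ = ∫ x, eval x p ∂μ) ∧
        ∫ x, a x τ ∂μ = τ * ∫ x, eval x Φ ∂μ := by
  obtain ⟨A, hG⟩ : ∃ A, Growth W R A := exists_growth W hR
  have hA := hG.1
  refine ⟨1 / (2 * A), by positivity, ?_⟩
  set τ := 1 / (2 * A) with hτ
  have hτ0 : 0 < τ := by positivity
  have hτA : τ * A < 1 := by rw [hτ]; field_simp; norm_num
  have htA : ∀ t ∈ Set.Icc 0 τ, |t| * A < 1 := by
    intro t ht
    rw [abs_of_nonneg ht.1]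
    exact (mul_le_mul_of_nonneg_right ht.2 hA.le).trans_lt hτA
  have hτm : |τ| * A < 1 := htA τ ⟨hτ0.le, le_rfl⟩
  set P : ℕ → MvPolynomial σ ℝ := fun k => if k = 0 then 0 else it W (k-1) Φ with hPdef
  obtain ⟨c0, hc0, hΦ⟩ := hG.2 Φ
  have hP : ∀ k, ∀ x ∈ box σ R, |eval x (P k)| ≤ (c0 / A) * A ^ k * k.factorial := by
    intro k x hx
    rcases k with _ | k
    · simp [hPdef]; positivity
    · simp only [hPdef, Nat.add_eq_zero_iff, one_ne_zero, and_false, if_false, Nat.add_sub_cancel]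
      refine (hΦ k x hx).trans ?_
      have e : c0 / A * A ^ (k+1) = c0 * A ^ k := by rw [pow_succ]; field_simp
      rw [e]
      have : (k.factorial : ℝ) ≤ (k+1).factorial := by exact_mod_cast Nat.factorial_le (Nat.le_succ k)
      gcongr
  have hS : ∀ p, ContinuousOn (fun x => S W x τ p) (box σ R) := by
    intro p
    obtain ⟨c1, _, h1⟩ := hG.2 p
    exact series_cont hA h1 hτm
  refine ⟨fun x t i => S W x t (X i), fun x t => Egf (fun k => eval x (P k)) t, ?_, ?_, ?_, ?_, ?_,
    ?_, ?_⟩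
  · intro x; ext i; simp [S, egf_zero, it_zero]
  · intro x; simp [egf_zero, hPdef]
  · intro x hx t ht
    rw [hasDerivAt_pi]
    intro i
    have h := S_hasDerivAt hG hx (htA t ht) (X i)
    rwa [lie_X, S_eq_eval hG hx (htA t ht)] at h
  · intro x hx t ht
    have h := egf_hasDerivAt hA (fun k => hP k x hx) (htA t ht)
    have e : Egf (fun k => eval x (P (k+1))) t = S W x t Φ := by simp [S, hPdef]
    rwa [e, S_eq_eval hG hx (htA t ht)] at h
  · rw [continuousOn_pi]
    exact fun i => hS (X i)
  · exact series_cont hA hP hτm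
  · intro μ hμ hbox hinv
    have hit : ∀ k p, ∫ x, eval x (it W (k+1) p) ∂μ = 0 := by
      intro k p; rw [it_succ]; exact hinv _
    constructor
    · intro p
      obtain ⟨c1, _, h1⟩ := hG.2 p
      have e : ∫ x, eval (fun i => S W x τ (X i)) p ∂μ =
          ∫ x, Egf (fun k => eval x (it W k p)) τ ∂μ := by
        refine integral_congr_ae ?_
        filter_upwards [hbox] with x hx
        exact (S_eq_eval hG hx hτm p).symm
      rw [e, series_integral hA h1 hτm μ hbox, Egf, tsum_eq_single 0]
      · simp [it_zero]
      · intro k hk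
        obtain ⟨m, rfl⟩ : ∃ m, k = m + 1 := ⟨k-1, by omega⟩
        rw [hit, mul_zero]
    · rw [series_integral hA hP hτm μ hbox, Egf, tsum_eq_single 1]
      · simp [hPdef, it_zero]
      · intro k hk
        rcases k with _ | _ | m
        · simp [hPdef]
        · simp at hk
        · simp only [hPdef, Nat.add_eq_zero_iff, one_ne_zero, and_false, if_false,
            Nat.add_sub_cancel]
          rw [hit, mul_zero]

end PolyFlow

namespace PolyFlow

theorem birkhoff_pos {X : Type*} [TopologicalSpace X] [T2Space X] [MeasurableSpace X] [BorelSpace X]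
    {μ : Measure X} [IsProbabilityMeasure μ] {Z : Set X} (hZ : IsCompact Z) {T : X → X}
    (hT : MeasurePreserving T μ μ) (hmap : Set.MapsTo T Z Z) (hTc : ContinuousOn T Z)
    (hμZ : ∀ᵐ x ∂μ, x ∈ Z) {f : X → ℝ} (hf : ContinuousOn f Z) (hpos : 0 < ∫ x, f x ∂μ) :
    ∃ x ∈ Z, ∀ k, 0 ≤ birkhoffSum T f k x := by
  by_contra! hcon
  have hres : μ.restrict Z = μ := Measure.restrict_eq_self_of_ae_mem hμZ
  have hIntg : Integrable f μ := by
    have := hf.integrableOn_compact (μ := μ) hZ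
    rwa [IntegrableOn, hres] at this
  have hBc : ∀ k, ContinuousOn (birkhoffSum T f k) Z := by
    intro k
    unfold birkhoffSum
    exact continuousOn_finsetSum _ fun j _ =>
      hf.comp (hTc.iterate hmap j) (hmap.iterate j)
  obtain ⟨N, hN⟩ : ∃ N, ∀ x ∈ Z, x ∈ Z → ∃ k ≤ N, birkhoffSum T f k x < 0 := by
    refine hZ.induction_on (p := fun s => ∃ N, ∀ x ∈ s, x ∈ Z → ∃ k ≤ N, birkhoffSum T f k x < 0)
      ⟨0, by simp⟩ ?_ ?_ ?_
    · rintro s t hst ⟨N, h⟩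
      exact ⟨N, fun x hx => h x (hst hx)⟩
    · rintro s t ⟨N, h⟩ ⟨M, h'⟩
      refine ⟨max N M, ?_⟩
      rintro x (hx | hx) hxZ
      · obtain ⟨k, hk, h1⟩ := h x hx hxZ
        exact ⟨k, hk.trans (le_max_left _ _), h1⟩
      · obtain ⟨k, hk, h1⟩ := h' x hx hxZ
        exact ⟨k, hk.trans (le_max_right _ _), h1⟩
    · intro x hx
      obtain ⟨k, hk⟩ := hcon x hx
      refine ⟨_, (hBc k x hx).eventually (gt_mem_nhds hk), k, ?_⟩
      intro y hy _
      exact ⟨k, le_rfl, hy⟩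
  obtain ⟨C0, hC0⟩ : ∃ C0, ∀ x ∈ Z, ‖f x‖ ≤ C0 := hZ.exists_bound_of_continuousOn hf
  have hb : ∀ n, ∀ x ∈ Z, birkhoffSum T f n x ≤ N * C0 := by
    intro n
    induction n using Nat.strong_induction_on with
    | _ n ih =>
      intro x hx
      have hC : 0 ≤ C0 := (norm_nonneg _).trans (hC0 x hx)
      rcases le_or_gt n N with h | h
      · have h1 : birkhoffSum T f n x ≤ n * C0 := by
          unfold birkhoffSum
          refine (Finset.sum_le_card_nsmul _ _ C0 fun j _ => ?_).trans (by simp)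
          exact (le_abs_self _).trans (hC0 _ (hmap.iterate j hx))
        refine h1.trans ?_
        gcongr
      · obtain ⟨k, hk, hneg⟩ := hN x hx hx
        have hk0 : k ≠ 0 := by rintro rfl; simp at hneg
        obtain ⟨m, rfl⟩ : ∃ m, n = k + m := ⟨n - k, by omega⟩
        rw [birkhoffSum_add]
        have := ih m (by omega) (T^[k] x) (hmap.iterate k hx)
        linarith
  have hj : ∀ j, Integrable (fun x => f (T^[j] x)) μ ∧ ∫ x, f (T^[j] x) ∂μ = ∫ x, f x ∂μ := by
    intro j
    have hp := hT.iterate j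
    constructor
    · exact hp.integrable_comp_of_integrable hIntg
    · have := integral_map (μ := μ) hp.measurable.aemeasurable (f := f)
        (by rw [hp.map_eq]; exact hIntg.aestronglyMeasurable)
      rw [hp.map_eq] at this
      exact this.symm
  have hn : ∀ n : ℕ, n * ∫ x, f x ∂μ ≤ N * C0 := by
    intro n
    have h1 : ∫ x, birkhoffSum T f n x ∂μ = n * ∫ x, f x ∂μ := by
      unfold birkhoffSum
      rw [integral_finsetSum _ fun j _ => (hj j).1]
      simp [(hj _).2]
    have h2 : ∫ x, birkhoffSum T f n x ∂μ ≤ ∫ x, N * C0 ∂μ := by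
      refine integral_mono_ae ?_ (integrable_const _) ?_
      · unfold birkhoffSum
        exact integrable_finsetSum _ fun j _ => (hj j).1
      · filter_upwards [hμZ] with x hx
        exact hb n x hx
    rw [h1] at h2
    simpa using h2
  obtain ⟨n, hn'⟩ := exists_nat_gt (N * C0 / ∫ x, f x ∂μ)
  rw [div_lt_iff₀ hpos] at hn'
  linarith [hn n]

theorem exists_orbit {σ : Type*} [Fintype σ] {K : Set (σ → ℝ)} (hK : IsCompact K)
    {φ : (σ → ℝ) → (σ → ℝ)} (hφ : ContinuousOn φ K) {G : (σ → ℝ) → ℝ} (hG : ContinuousOn G K)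
    (μ : Measure (σ → ℝ)) [IsProbabilityMeasure μ] (hμ : ∀ᵐ x ∂μ, x ∈ K)
    (hinv : ∀ p, ∫ x, eval (φ x) p ∂μ = ∫ x, eval x p ∂μ) {c : ℝ} (hc : c < ∫ x, G x ∂μ) :
    ∃ Z ⊆ K, Set.MapsTo φ Z Z ∧ ∃ x ∈ Z, ∀ k : ℕ, k * c ≤ birkhoffSum φ G k x := by
  classical
  set T := K.piecewise φ id with hTdef
  have hTm : Measurable T := hφ.measurable_piecewise continuousOn_id hK.measurableSet
  have hTK : ∀ x ∈ K, T x = φ x := fun x hx => Set.piecewise_eq_of_mem _ _ _ hx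
  have hν : IsProbabilityMeasure (μ.map T) := Measure.isProbabilityMeasure_map hTm.aemeasurable
  have hT : MeasurePreserving T μ μ := by
    refine ⟨hTm, ?_⟩
    have hK2 : IsCompact (K ∪ φ '' K) := hK.union (hK.image_of_continuousOn hφ)
    refine ArchQM.measure_ext_moments hK2 ?_ ?_ ?_
    · rw [ae_map_iff hTm.aemeasurable (by exact hK2.measurableSet)]
      filter_upwards [hμ] with x hx
      rw [hTK x hx]
      exact Or.inr ⟨x, hx, rfl⟩
    · filter_upwards [hμ] with x hx using Or.inl hx
    · intro p
      rw [integral_map hTm.aemeasurable (MvPolynomial.continuous_eval p).aestronglyMeasurable,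
        ← hinv]
      refine integral_congr_ae ?_
      filter_upwards [hμ] with x hx
      rw [hTK x hx]
  have hZK : μ.support ⊆ K := Measure.support_subset_of_isClosed hK.isClosed hμ
  have hZc : IsCompact μ.support := hK.of_isClosed_subset Measure.isClosed_support hZK
  have hmap : Set.MapsTo φ μ.support μ.support := by
    intro x hx
    rw [Measure.mem_support_iff_forall]
    intro U hU
    obtain ⟨U', hU'U, hU'o, hxU'⟩ := mem_nhds_iff.1 hU
    have h1 : φ ⁻¹' U' ∈ nhdsWithin x K := hφ x (hZK hx) (hU'o.mem_nhds hxU')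
    obtain ⟨V, hV, hVK⟩ := mem_nhdsWithin_iff_exists_mem_nhds_inter.1 h1
    have h2 : 0 < μ V := (Measure.mem_support_iff_forall x).1 hx V hV
    calc 0 < μ V := h2
      _ ≤ μ (T ⁻¹' U') := by
        refine measure_mono_ae ?_
        filter_upwards [hμ] with y hy hyV
        change T y ∈ U'
        rw [hTK y hy]
        exact hVK ⟨hyV, hy⟩
      _ = μ U' := hT.measure_preimage hU'o.measurableSet.nullMeasurableSet
      _ ≤ μ U := measure_mono hU'U
  have hTφ : Set.EqOn T φ μ.support := fun x hx => hTK x (hZK hx)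
  have hmapT : Set.MapsTo T μ.support μ.support := fun x hx => by rw [hTφ hx]; exact hmap hx
  have hGi : Integrable G μ := by
    have := hG.integrableOn_compact (μ := μ) hK
    rwa [IntegrableOn, Measure.restrict_eq_self_of_ae_mem hμ] at this
  obtain ⟨x, hx, h⟩ := birkhoff_pos hZc hT hmapT ((hφ.mono hZK).congr hTφ)
    (Measure.support_mem_ae) (f := fun x => G x - c) ((hG.mono hZK).sub continuousOn_const)
    (by rw [integral_sub hGi (integrable_const _)]; simpa using hc)
  refine ⟨μ.support, hZK, hmap, x, hx, fun k => ?_⟩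
  have hit : ∀ j, T^[j] x = φ^[j] x := by
    intro j
    induction j with
    | zero => rfl
    | succ j ih =>
      rw [Function.iterate_succ_apply', Function.iterate_succ_apply', ih]
      exact hTφ (hmap.iterate j hx)
  have := h k
  unfold birkhoffSum at this ⊢
  simp only [hit] at this
  rw [Finset.sum_sub_distrib] at this
  simp at this
  linarith

end PolyFlow

namespace PolyFlow

theorem glue {E : Type*} [NormedAddCommGroup E] [NormedSpace ℝ E] {f φ : E → E} {Z : Set E}
    (hmap : Set.MapsTo φ Z Z) {τ : ℝ} (hτ : 0 < τ) {c : E → ℝ → E} (hc0 : ∀ x ∈ Z, c x 0 = x)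
    (hcτ : ∀ x ∈ Z, c x τ = φ x)
    (hc : ∀ x ∈ Z, ∀ t ∈ Set.Icc 0 τ, HasDerivAt (c x) (f (c x t)) t) {x0 : E} (hx0 : x0 ∈ Z) :
    ∃ γ : ℝ → E, (∀ t, 0 ≤ t → HasDerivAt γ (f (γ t)) t) ∧ ∀ j : ℕ, γ (j * τ) = φ^[j] x0 := by
  set d : ℕ → ℝ → E := fun m t => c (φ^[m] x0) (t - m * τ) with hd
  set γ : ℝ → E := fun t => d ⌊t / τ⌋₊ t with hγ
  have hZ : ∀ m, φ^[m] x0 ∈ Z := fun m => hmap.iterate m hx0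
  have hj : ∀ j : ℕ, γ (j * τ) = φ^[j] x0 := by
    intro j
    have : (j * τ) / τ = j := by field_simp
    simp only [hγ, hd, this, Nat.floor_natCast, sub_self]
    exact hc0 _ (hZ j)
  have hco : ∀ m : ℕ, ∀ t, m * τ ≤ t → t < (m+1) * τ → γ t = d m t := by
    intro m t h1 h2
    have : ⌊t / τ⌋₊ = m := by
      rw [Nat.floor_eq_iff (by have : 0 ≤ m * τ := by positivity
                               have : 0 ≤ t := by linarith
                               positivity)]
      rw [le_div_iff₀ hτ, div_lt_iff₀ hτ]
      exact ⟨h1, h2⟩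
    simp only [hγ, this]
  have hcc : ∀ m : ℕ, ∀ t ∈ Set.Icc (m * τ) ((m+1) * τ), γ t = d m t := by
    intro m t ht
    rcases ht.2.lt_or_eq with h | h
    · exact hco m t ht.1 h
    · have h2 := hj (m+1)
      push_cast at h2
      rw [h, h2, hd]
      have : ((m:ℝ) + 1) * τ - m * τ = τ := by ring
      simp only [this]
      rw [hcτ _ (hZ m), Function.iterate_succ_apply']
  have hneg : ∀ t ≤ 0, γ t = d 0 t := by
    intro t ht
    have : ⌊t / τ⌋₊ = 0 := Nat.floor_of_nonpos (div_nonpos_of_nonpos_of_nonneg ht hτ.le)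
    simp only [hγ, this]
  have hdd : ∀ m : ℕ, ∀ t ∈ Set.Icc (m * τ) ((m+1) * τ), HasDerivAt (d m) (f (γ t)) t := by
    intro m t ht
    rw [hcc m t ht]
    have h1 := hc _ (hZ m) (t - m * τ) ⟨by linarith [ht.1], by linarith [ht.2]⟩
    exact h1.comp_sub_const t (m * τ)
  refine ⟨γ, fun t ht => ?_, hj⟩
  have hR : HasDerivWithinAt γ (f (γ t)) (Set.Ici t) t := by
    set m := ⌊t / τ⌋₊ with hm
    have h1 : m * τ ≤ t := by
      rw [← le_div_iff₀ hτ]; exact Nat.floor_le (by positivity)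
    have h2 : t < (m+1) * τ := by
      rw [← div_lt_iff₀ hτ]; exact Nat.lt_floor_add_one _
    refine (hdd m t ⟨h1, h2.le⟩).hasDerivWithinAt.congr_of_eventuallyEq ?_ (hcc m t ⟨h1, h2.le⟩)
    filter_upwards [Icc_mem_nhdsGE h2] with s hs
    exact hcc m s ⟨h1.trans hs.1, hs.2⟩
  have hL : HasDerivWithinAt γ (f (γ t)) (Set.Iic t) t := by
    rcases ht.eq_or_lt with h0 | h0
    · subst h0
      have hm : (0:ℝ) ∈ Set.Icc (((0:ℕ):ℝ) * τ) ((((0:ℕ):ℝ)+1) * τ) := by simp [hτ.le]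
      refine (hdd 0 0 hm).hasDerivWithinAt.congr_of_eventuallyEq ?_ (hcc 0 0 hm)
      filter_upwards [self_mem_nhdsWithin] with s hs
      exact hneg s hs
    · obtain ⟨m, hm⟩ : ∃ m : ℕ, ⌈t / τ⌉₊ = m + 1 :=
        ⟨⌈t / τ⌉₊ - 1, by have := Nat.ceil_pos.2 (div_pos h0 hτ); omega⟩
      have h1 : m * τ < t := by
        rw [← lt_div_iff₀ hτ]; exact Nat.lt_ceil.1 (by omega)
      have h2 : t ≤ (m+1) * τ := by
        rw [← div_le_iff₀ hτ]
        have := Nat.le_ceil (t / τ)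
        rw [hm] at this
        exact_mod_cast this
      refine (hdd m t ⟨h1.le, h2⟩).hasDerivWithinAt.congr_of_eventuallyEq ?_ (hcc m t ⟨h1.le, h2⟩)
      filter_upwards [Icc_mem_nhdsLE h1] with s hs
      exact hcc m s ⟨hs.1, hs.2.trans h2⟩
  have := hL.union hR
  rwa [Set.Iic_union_Ici, hasDerivWithinAt_univ] at this

theorem exists_trajectory {σ : Type*} [Fintype σ] {Q : Set (MvPolynomial σ ℝ)}
    (hQ : ArchQM Q) (W : σ → MvPolynomial σ ℝ) (Φ : MvPolynomial σ ℝ) {U0 U : ℝ}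
    (hinf : ∀ V, C U0 - Φ - lie W V ∉ Q) (hU : U < U0) :
    ∃ (γ : ℝ → σ → ℝ) (a : ℝ → ℝ) (τ : ℝ), 0 < τ ∧ γ 0 ∈ ArchQM.pos Q ∧ a 0 = 0 ∧
      (∀ t, 0 ≤ t → HasDerivAt γ (fun i => eval (γ t) (W i)) t) ∧
      (∀ t, 0 ≤ t → HasDerivAt a (eval (γ t) Φ) t) ∧
      (∀ k : ℕ, k * (τ * U) ≤ a (k * τ)) ∧ ∀ k : ℕ, γ (k * τ) ∈ ArchQM.pos Q := by
  obtain ⟨L, hL, hLD, hLp⟩ := hQ.exists_state (lie W : MvPolynomial σ ℝ →ₗ[ℝ] MvPolynomial σ ℝ)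
    (C U0 - Φ) hinf
  obtain ⟨μ, hμ, hμK, hμL⟩ := hQ.exists_measure hL
  obtain ⟨R, hR, hbox⟩ := hQ.exists_box
  obtain ⟨τ, hτ, c, a, hc0, ha0, hcd, had, hcc, hac, hIntg⟩ := exists_flow W Φ hR
  have hK : ArchQM.pos Q ⊆ box σ R := fun x hx => hbox x hx
  have hae : ∀ᵐ x ∂μ, x ∈ ArchQM.pos Q := by
    rw [ae_iff]; exact hμK
  have hΦ : U0 ≤ ∫ x, eval x Φ ∂μ := by
    rw [hμL]
    rw [map_sub, ArchQM.map_C hL.2] at hLp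
    linarith
  obtain ⟨h1, h2⟩ := hIntg μ hμ (hae.mono fun x hx => hK hx)
    (fun p => by rw [hμL]; exact hLD p)
  have hlt : τ * U < ∫ x, a x τ ∂μ := by
    rw [h2]
    exact mul_lt_mul_of_pos_left (hU.trans_le hΦ) hτ
  obtain ⟨Z, hZK, hmap, x, hx, hB⟩ := exists_orbit hQ.isCompact_pos (hcc.mono hK) (hac.mono hK) μ
    hae h1 hlt
  obtain ⟨γ, hγ, hγj⟩ := glue (E := (σ → ℝ) × ℝ)
    (f := fun y => (fun i => eval y.1 (W i), eval y.1 Φ))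
    (φ := fun y => (c y.1 τ, y.2 + a y.1 τ)) (Z := Z ×ˢ Set.univ)
    (fun y hy => ⟨hmap hy.1, trivial⟩) hτ (c := fun y t => (c y.1 t, y.2 + a y.1 t))
    (fun y _ => by simp [hc0, ha0]) (fun y _ => rfl)
    (fun y hy t ht => (hcd _ (hK (hZK hy.1)) t ht).prodMk
      ((had _ (hK (hZK hy.1)) t ht).const_add y.2)) (x0 := (x, 0)) ⟨hx, trivial⟩
  have hit : ∀ j : ℕ, (fun y : (σ → ℝ) × ℝ => (c y.1 τ, y.2 + a y.1 τ))^[j] (x, 0) =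
      ((fun x => c x τ)^[j] x, birkhoffSum (fun x => c x τ) (fun x => a x τ) j x) := by
    intro j
    induction j with
    | zero => simp
    | succ j ih =>
      rw [Function.iterate_succ_apply', ih, Function.iterate_succ_apply', birkhoffSum_succ]
  have hmemj : ∀ k : ℕ, (γ (k * τ)).1 ∈ ArchQM.pos Q := by
    intro k; rw [hγj, hit]; exact hZK (hmap.iterate k hx)
  refine ⟨fun t => (γ t).1, fun t => (γ t).2, τ, hτ, ?_, ?_, ?_, ?_, ?_, hmemj⟩
  · simpa using hmemj 0
  · have := hγj 0
    simp at this
    simp [this]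
  · intro t ht
    exact (hasFDerivAt_fst.comp_hasDerivAt t (hγ t ht) :)
  · intro t ht
    exact (hasFDerivAt_snd.comp_hasDerivAt t (hγ t ht) :)
  · intro k
    dsimp only
    rw [hγj, hit]
    exact hB k

end PolyFlow

namespace LyapSOS

section sos
variable {σ : Type*}

theorem sos_zero : IsSOS (0 : MvPolynomial σ ℝ) := ⟨0, Fin.elim0, by simp⟩

theorem sos_add {p q : MvPolynomial σ ℝ} (hp : IsSOS p) (hq : IsSOS q) : IsSOS (p + q) := by
  obtain ⟨K, a, rfl⟩ := hp
  obtain ⟨M, b, rfl⟩ := hq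
  exact ⟨K + M, Fin.append a b, by simp [Fin.sum_univ_add]⟩

theorem sos_sq (a : MvPolynomial σ ℝ) : IsSOS (a ^ 2) := ⟨1, fun _ => a, by simp⟩

theorem sos_sq_mul (a : MvPolynomial σ ℝ) {p : MvPolynomial σ ℝ} (hp : IsSOS p) :
    IsSOS (a ^ 2 * p) := by
  obtain ⟨K, b, rfl⟩ := hp
  exact ⟨K, fun k => a * b k, by simp [Finset.mul_sum, mul_pow]⟩

theorem sos_sum {ι : Type*} (s : Finset ι) (p : ι → MvPolynomial σ ℝ) (h : ∀ i ∈ s, IsSOS (p i)) :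
    IsSOS (∑ i ∈ s, p i) := by
  classical
  induction s using Finset.induction_on with
  | empty => simpa using sos_zero
  | insert a s ha ih =>
    rw [Finset.sum_insert ha]
    exact sos_add (h a (Finset.mem_insert_self _ _))
      (ih fun i hi => h i (Finset.mem_insert_of_mem hi))

theorem sos_rename {ρ : Type*} (f : σ → ρ) {p : MvPolynomial σ ℝ} (hp : IsSOS p) :
    IsSOS (rename f p) := by
  obtain ⟨K, b, rfl⟩ := hp
  exact ⟨K, fun k => rename f (b k), by simp⟩

theorem sos_eval {p : MvPolynomial σ ℝ} (hp : IsSOS p) (x : σ → ℝ) : 0 ≤ eval x p := by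
  obtain ⟨K, b, rfl⟩ := hp
  rw [map_sum]
  exact Finset.sum_nonneg fun k _ => by rw [map_pow]; positivity

end sos

variable {n I J : ℕ} (F : Fin n → MvPolynomial (Fin n) ℝ)
    (g : Fin I → MvPolynomial (Fin n) ℝ) (h : Fin J → MvPolynomial (Fin n) ℝ)

/-- the quadratic module of the problem -/
def QM : Set (MvPolynomial (Fin n ⊕ Fin n) ℝ) :=
  {p | ∃ (ρ₀ : MvPolynomial (Fin n ⊕ Fin n) ℝ)
        (ρ : Fin J → MvPolynomial (Fin n ⊕ Fin n) ℝ)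
        (σ : Fin I → MvPolynomial (Fin n ⊕ Fin n) ℝ),
        (∀ i, IsSOS (σ i)) ∧
        IsSOS (p - ∑ i, σ i * rename Sum.inl (g i) - ρ₀ * hZero n
          - ∑ j, ρ j * rename Sum.inl (h j))}

variable {g h}

theorem qm_add {p q : MvPolynomial (Fin n ⊕ Fin n) ℝ} (hp : p ∈ QM g h) (hq : q ∈ QM g h) :
    p + q ∈ QM g h := by
  obtain ⟨a, b, s, h1, h2⟩ := hp
  obtain ⟨a', b', s', h1', h2'⟩ := hq
  refine ⟨a + a', fun j => b j + b' j, fun i => s i + s' i, fun i => sos_add (h1 i) (h1' i), ?_⟩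
  have := sos_add h2 h2'
  convert this using 1
  simp only [add_mul, Finset.sum_add_distrib]
  ring

theorem qm_sq_mul (c : MvPolynomial (Fin n ⊕ Fin n) ℝ) {p : MvPolynomial (Fin n ⊕ Fin n) ℝ}
    (hp : p ∈ QM g h) : c ^ 2 * p ∈ QM g h := by
  obtain ⟨a, b, s, h1, h2⟩ := hp
  refine ⟨c ^ 2 * a, fun j => c ^ 2 * b j, fun i => c ^ 2 * s i, fun i => sos_sq_mul c (h1 i), ?_⟩
  convert sos_sq_mul c h2 using 1
  simp only [mul_sub, Finset.mul_sum, mul_assoc]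

theorem qm_sos {p : MvPolynomial (Fin n ⊕ Fin n) ℝ} (hp : IsSOS p) : p ∈ QM g h :=
  ⟨0, 0, 0, fun _ => sos_zero, by simpa using hp⟩

theorem qm_hZero (c : MvPolynomial (Fin n ⊕ Fin n) ℝ) : c * hZero n ∈ QM g h :=
  ⟨c, 0, 0, fun _ => sos_zero, by simpa using sos_zero⟩

theorem qm_h (c : MvPolynomial (Fin n ⊕ Fin n) ℝ) (j : Fin J) :
    c * rename Sum.inl (h j) ∈ QM g h := by
  classical
  exact ⟨0, Pi.single j c, 0, fun _ => sos_zero, by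
    simpa [Pi.single_apply, ite_mul] using sos_zero⟩

theorem qm_g (i : Fin I) : rename Sum.inl (g i) ∈ QM g h := by
  classical
  refine ⟨0, 0, Pi.single i 1, fun k => ?_, by simpa [Pi.single_apply, ite_mul] using sos_zero⟩
  rw [Pi.single_apply]
  split_ifs
  · simpa using sos_sq (1 : MvPolynomial (Fin n ⊕ Fin n) ℝ)
  · exact sos_zero

theorem qm_arch (hArch : ∃ (R : ℝ) (τ₀ : MvPolynomial (Fin n) ℝ) (τ : Fin I → MvPolynomial (Fin n) ℝ)
        (π : Fin J → MvPolynomial (Fin n) ℝ), IsSOS τ₀ ∧ (∀ i, IsSOS (τ i)) ∧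
        C R - ∑ k, X k ^ 2 = τ₀ + ∑ i, τ i * g i + ∑ j, π j * h j) : ArchQM (QM g h) where
  add p hp q hq := qm_add hp hq
  sq a := qm_sos (sos_sq a)
  sq_mul a q hq := qm_sq_mul a hq
  arch i := by
    classical
    rcases i with i | i
    · obtain ⟨R, τ₀, τ, π, h0, h1, h2⟩ := hArch
      refine ⟨R, ?_⟩
      have h3 : rename Sum.inl (C R - ∑ k, X k ^ 2) ∈ QM g h := by
        rw [h2]
        refine ⟨0, fun j => rename Sum.inl (π j), fun i => rename Sum.inl (τ i),
          fun i => sos_rename _ (h1 i), ?_⟩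
        convert sos_rename Sum.inl h0 using 1
        simp only [map_add, map_sum, map_mul]
        ring
      have h4 : (∑ k ∈ Finset.univ.erase i, X (Sum.inl k) ^ 2 : MvPolynomial (Fin n ⊕ Fin n) ℝ)
          ∈ QM g h := qm_sos (sos_sum _ _ fun k _ => sos_sq _)
      convert qm_add h3 h4 using 1
      simp only [map_sub, map_sum, map_pow, rename_C, rename_X]
      rw [← Finset.add_sum_erase _ _ (Finset.mem_univ i)]
      ring
    · refine ⟨1, ?_⟩
      have h4 : (∑ k ∈ Finset.univ.erase i, X (Sum.inr k) ^ 2 : MvPolynomial (Fin n ⊕ Fin n) ℝ)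
          ∈ QM g h := qm_sos (sos_sum _ _ fun k _ => sos_sq _)
      convert qm_add (qm_hZero 1) h4 using 1
      rw [one_mul, hZero, ← Finset.add_sum_erase _ _ (Finset.mem_univ i), map_one]
      ring

theorem mem_pos (u : Fin n ⊕ Fin n → ℝ) : u ∈ ArchQM.pos (QM g h) ↔
    ((∀ i, 0 ≤ eval (fun k => u (Sum.inl k)) (g i)) ∧ ∀ j, eval (fun k => u (Sum.inl k)) (h j) = 0)
      ∧ ∑ i, u (Sum.inr i) ^ 2 = 1 := by
  have hz : eval u (hZero n) = 1 - ∑ i, u (Sum.inr i) ^ 2 := by simp [hZero]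
  have er : ∀ p : MvPolynomial (Fin n) ℝ, eval u (rename Sum.inl p) =
      eval (fun k => u (Sum.inl k)) p := fun p => by rw [eval_rename]; rfl
  constructor
  · intro hu
    refine ⟨⟨fun i => ?_, fun j => ?_⟩, ?_⟩
    · have := hu _ (qm_g i)
      rwa [er] at this
    · have h1 := hu _ (qm_h 1 j)
      have h2 := hu _ (qm_h (-1) j)
      simp only [map_mul, map_one, map_neg, er] at h1 h2
      linarith
    · have h1 := hu _ (qm_hZero 1)
      have h2 := hu _ (qm_hZero (-1))
      simp only [map_mul, map_one, map_neg, hz] at h1 h2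
      linarith
  · rintro ⟨⟨h1, h2⟩, h3⟩ p ⟨ρ₀, ρ, s, hs, hp⟩
    have := sos_eval hp u
    simp only [map_sub, map_sum, map_mul, er, h2, hz, h3, sub_self, mul_zero,
      Finset.sum_const_zero, sub_zero] at this
    have h4 : 0 ≤ ∑ i, eval u (s i) * eval (fun k => u (Sum.inl k)) (g i) :=
      Finset.sum_nonneg fun i _ => mul_nonneg (sos_eval (hs i) u) (h1 i)
    linarith

/-- the projectivised vector field -/
noncomputable def WW : Fin n ⊕ Fin n → MvPolynomial (Fin n ⊕ Fin n) ℝ :=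
  Sum.elim (fun i => rename Sum.inl (F i))
    (fun k => (∑ i, rename Sum.inl (pderiv i (F k)) * X (Sum.inr i)) - PhiPoly F * X (Sum.inr k))

theorem Ppoly_eq (U : ℝ) (V : MvPolynomial (Fin n ⊕ Fin n) ℝ) :
    Ppoly F U V = C U - PhiPoly F - PolyFlow.lie (WW F) V := by
  rw [PolyFlow.lie_eq, Fintype.sum_sum_type, Ppoly]
  simp only [WW, Sum.elim_inl, Sum.elim_inr]
  ring

theorem eval_Phi (u : Fin n ⊕ Fin n → ℝ) : eval u (PhiPoly F) =
    ∑ k, u (Sum.inr k) * ∑ i, eval (fun k => u (Sum.inl k)) (pderiv i (F k)) * u (Sum.inr i) := by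
  simp only [PhiPoly, map_sum, map_mul, eval_X, eval_rename, Finset.mul_sum, mul_assoc]
  rfl

theorem eval_WW_inl (u : Fin n ⊕ Fin n → ℝ) (i : Fin n) : eval u (WW F (Sum.inl i)) =
    eval (fun k => u (Sum.inl k)) (F i) := by
  simp only [WW, Sum.elim_inl, eval_rename]; rfl

theorem eval_WW_inr (u : Fin n ⊕ Fin n → ℝ) (k : Fin n) : eval u (WW F (Sum.inr k)) =
    (∑ i, eval (fun k => u (Sum.inl k)) (pderiv i (F k)) * u (Sum.inr i))
      - eval u (PhiPoly F) * u (Sum.inr k) := by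
  simp only [WW, Sum.elim_inr, map_sub, map_sum, map_mul, eval_X, eval_rename]; rfl

theorem hasFDerivAt_eval {σ : Type*} [Fintype σ] (p : MvPolynomial σ ℝ) (x : σ → ℝ) :
    HasFDerivAt (fun x : σ → ℝ => eval x p)
      (∑ i, eval x (pderiv i p) • (ContinuousLinearMap.proj i : (σ → ℝ) →L[ℝ] ℝ)) x := by
  classical
  induction p using MvPolynomial.induction_on with
  | C a => simpa using hasFDerivAt_const a x
  | add p q hp hq =>
    simp only [map_add]
    refine (hp.fun_add hq).congr_fderiv ?_
    ext v
    simp [add_mul, Finset.sum_add_distrib]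
  | mul_X p i hp =>
    have h1 : HasFDerivAt (fun x : σ → ℝ => x i) (ContinuousLinearMap.proj i : (σ → ℝ) →L[ℝ] ℝ) x :=
      (ContinuousLinearMap.proj i : (σ → ℝ) →L[ℝ] ℝ).hasFDerivAt
    simp only [map_mul, eval_X]
    refine (hp.fun_mul h1).congr_fderiv ?_
    ext v
    simp [Derivation.leibniz, pderiv_X, Pi.single_apply, add_mul, Finset.sum_add_distrib,
      Finset.mul_sum, mul_assoc, apply_ite (eval x), ite_mul]

theorem hasDerivAt_eval {σ : Type*} [Fintype σ] (p : MvPolynomial σ ℝ) {γ : ℝ → σ → ℝ} {w : σ → ℝ}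
    {t : ℝ} (hγ : HasDerivAt γ w t) :
    HasDerivAt (fun s => eval (γ s) p) (∑ i, eval (γ t) (pderiv i p) * w i) t := by
  have := (hasFDerivAt_eval p (γ t)).comp_hasDerivAt t hγ
  refine this.congr_deriv ?_
  simp

end LyapSOS

namespace LyapSOS

theorem anti_aux {u u' : ℝ → ℝ} (hu : ∀ t, 0 ≤ t → HasDerivAt u (u' t) t)
    (h : ∀ t, 0 ≤ t → u' t ≤ 0) {T : ℝ} (hT : 0 ≤ T) : u T ≤ u 0 := by
  have : AntitoneOn u (Set.Ici 0) := by
    refine antitoneOn_of_deriv_nonpos (convex_Ici 0)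
      (fun t ht => (hu t ht).continuousAt.continuousWithinAt) ?_ ?_
    · intro t ht
      rw [interior_Ici] at ht
      exact (hu t ht.le).differentiableAt.differentiableWithinAt
    · intro t ht
      rw [interior_Ici] at ht
      rw [(hu t ht.le).deriv]
      exact h t ht.le
  exact this Set.self_mem_Ici hT hT

variable {n I J : ℕ} {F : Fin n → MvPolynomial (Fin n) ℝ}
    {g : Fin I → MvPolynomial (Fin n) ℝ} {h : Fin J → MvPolynomial (Fin n) ℝ}

/-- the point `(x, y/‖y‖)` -/
noncomputable def proj (x y : Fin n → ℝ) : Fin n ⊕ Fin n → ℝ :=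
  Sum.elim x (fun k => y k / √(∑ i, y i ^ 2))

theorem proj_mem {x y : Fin n → ℝ} (hg : ∀ i, 0 ≤ eval x (g i)) (hh : ∀ j, eval x (h j) = 0)
    (hy : 0 < ∑ i, y i ^ 2) : proj x y ∈ ArchQM.pos (QM g h) := by
  rw [mem_pos]
  refine ⟨⟨hg, hh⟩, ?_⟩
  simp only [proj, Sum.elim_inr, div_pow, Real.sq_sqrt hy.le, ← Finset.sum_div]
  exact div_self hy.ne'

theorem proj_phi {x y : Fin n → ℝ} (hy : 0 < ∑ i, y i ^ 2) :
    ∑ k, y k * ∑ i, eval x (pderiv i (F k)) * y i =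
      (∑ i, y i ^ 2) * eval (proj x y) (PhiPoly F) := by
  rw [eval_Phi, Finset.mul_sum]
  refine Finset.sum_congr rfl fun k _ => ?_
  simp only [proj, Sum.elim_inr, Sum.elim_inl, Finset.mul_sum]
  refine Finset.sum_congr rfl fun i _ => ?_
  have h1 := Real.sq_sqrt hy.le
  have h2 : √(∑ i, y i ^ 2) ≠ 0 := (Real.sqrt_pos.2 hy).ne'
  field_simp
  rw [h1]

section traj

variable (hQ : ArchQM (QM g h)) {x y : ℝ → Fin n → ℝ}
    (hx : ∀ t, 0 ≤ t → ∀ i, HasDerivAt (fun s => x s i) (eval (x t) (F i)) t)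
    (hy : ∀ t, 0 ≤ t → ∀ k, HasDerivAt (fun s => y s k)
      (∑ i, eval (x t) (pderiv i (F k)) * y t i) t)
    (hB : ∀ t, 0 ≤ t → (∀ i, 0 ≤ eval (x t) (g i)) ∧ ∀ j, eval (x t) (h j) = 0)
    (hy0 : ∑ i, y 0 i ^ 2 = 1)

include hy in
theorem q_deriv (t : ℝ) (ht : 0 ≤ t) : HasDerivAt (fun s => ∑ i, y s i ^ 2)
    (2 * ∑ k, y t k * ∑ i, eval (x t) (pderiv i (F k)) * y t i) t := by
  have h1 : HasDerivAt (fun s => ∑ i, y s i ^ 2) _ t :=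
    HasDerivAt.fun_sum (u := Finset.univ) fun k _ => (hy t ht k).fun_pow 2
  refine h1.congr_deriv ?_
  rw [Finset.mul_sum]
  refine Finset.sum_congr rfl fun k _ => ?_
  push_cast
  ring

include hQ hy hB hy0 in
theorem q_bounds : ∃ c : ℝ, ∀ t, 0 ≤ t → Real.exp (-(2 * c * t)) ≤ ∑ i, y t i ^ 2 ∧
    ∑ i, y t i ^ 2 ≤ Real.exp (2 * c * t) := by
  obtain ⟨c, hc⟩ := hQ.isCompact_pos.exists_bound_of_continuousOn
    (MvPolynomial.continuous_eval (PhiPoly F)).continuousOn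
  have hD : ∀ t, 0 ≤ t → |∑ k, y t k * ∑ i, eval (x t) (pderiv i (F k)) * y t i| ≤
      c * ∑ i, y t i ^ 2 := by
    intro t ht
    have h0 : 0 ≤ ∑ i, y t i ^ 2 := Finset.sum_nonneg fun i _ => sq_nonneg _
    rcases h0.eq_or_lt with h1 | h1
    · have h2 : ∀ i, y t i = 0 := by
        intro i
        have := (Finset.sum_eq_zero_iff_of_nonneg (fun i _ => sq_nonneg (y t i))).1 h1.symm i
          (Finset.mem_univ i)
        simpa using this
      simp [h2]
    · rw [proj_phi h1, abs_mul, abs_of_pos h1, mul_comm]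
      exact mul_le_mul_of_nonneg_right (hc _ (proj_mem (hB t ht).1 (hB t ht).2 h1)) h0
  refine ⟨c, fun T hT => ⟨?_, ?_⟩⟩
  · have he : ∀ t : ℝ, HasDerivAt (fun s => Real.exp (2 * c * s)) (Real.exp (2 * c * t) * (2 * c)) t := by
      intro t
      have := ((hasDerivAt_id t).const_mul (2 * c)).exp
      simpa using this
    have := anti_aux (u := fun s => -((∑ i, y s i ^ 2) * Real.exp (2 * c * s)))
      (fun t ht => ((q_deriv hy t ht).fun_mul (he t)).fun_neg) (fun t ht => by
        have h1 := (abs_le.1 (hD t ht)).1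
        have h2 := Real.exp_pos (2 * c * t)
        nlinarith) hT
    simp only [hy0, mul_zero, Real.exp_zero, mul_one, neg_le_neg_iff] at this
    rw [Real.exp_neg, inv_le_iff_one_le_mul₀ (Real.exp_pos _)]
    exact this
  · have he : ∀ t : ℝ, HasDerivAt (fun s => Real.exp (-(2 * c * s)))
        (Real.exp (-(2 * c * t)) * -(2 * c)) t := by
      intro t
      have := (((hasDerivAt_id t).const_mul (2 * c)).fun_neg).exp
      simpa using this
    have := anti_aux (u := fun s => (∑ i, y s i ^ 2) * Real.exp (-(2 * c * s)))
      (fun t ht => ((q_deriv hy t ht).fun_mul (he t))) (fun t ht => by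
        have h1 := (abs_le.1 (hD t ht)).2
        have h2 := Real.exp_pos (-(2 * c * t))
        nlinarith) hT
    simp only [hy0, mul_zero, neg_zero, Real.exp_zero, mul_one] at this
    rw [Real.exp_neg, ← div_eq_mul_inv, div_le_one (Real.exp_pos _)] at this
    exact this

include hQ hx hy hB hy0 in
theorem log_bound {U : ℝ} {V : MvPolynomial (Fin n ⊕ Fin n) ℝ} (hP : Ppoly F U V ∈ QM g h) :
    ∃ M : ℝ, ∀ t, 0 ≤ t → Real.log (√(∑ i, y t i ^ 2)) ≤ U * t + M := by
  obtain ⟨c, hc⟩ := q_bounds hQ hy hB hy0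
  have hq : ∀ t, 0 ≤ t → 0 < ∑ i, y t i ^ 2 := fun t ht => (Real.exp_pos _).trans_le (hc t ht).1
  obtain ⟨M, hM⟩ := hQ.isCompact_pos.exists_bound_of_continuousOn
    (MvPolynomial.continuous_eval V).continuousOn
  have hmem : ∀ t, 0 ≤ t → proj (x t) (y t) ∈ ArchQM.pos (QM g h) := fun t ht =>
    proj_mem (hB t ht).1 (hB t ht).2 (hq t ht)
  have hr : ∀ t, 0 ≤ t → HasDerivAt (fun s => √(∑ i, y s i ^ 2))
      (√(∑ i, y t i ^ 2) * eval (proj (x t) (y t)) (PhiPoly F)) t := by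
    intro t ht
    have h1 := (q_deriv hy t ht).sqrt (hq t ht).ne'
    refine h1.congr_deriv ?_
    rw [proj_phi (hq t ht)]
    have h2 := Real.mul_self_sqrt (hq t ht).le
    have h3 : √(∑ i, y t i ^ 2) ≠ 0 := (Real.sqrt_pos.2 (hq t ht)).ne'
    rw [div_eq_iff (by positivity)]
    linear_combination (-2 * eval (proj (x t) (y t)) (PhiPoly F)) * h2
  have hl : ∀ t, 0 ≤ t → HasDerivAt (fun s => Real.log (√(∑ i, y s i ^ 2)))
      (eval (proj (x t) (y t)) (PhiPoly F)) t := by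
    intro t ht
    have h3 : √(∑ i, y t i ^ 2) ≠ 0 := (Real.sqrt_pos.2 (hq t ht)).ne'
    refine ((hr t ht).log h3).congr_deriv ?_
    field_simp
  have hu : ∀ t, 0 ≤ t → HasDerivAt (fun s => proj (x s) (y s))
      (fun i => eval (proj (x t) (y t)) (WW F i)) t := by
    intro t ht
    rw [hasDerivAt_pi]
    rintro (i | k)
    · rw [eval_WW_inl]
      exact hx t ht i
    · have h3 : √(∑ i, y t i ^ 2) ≠ 0 := (Real.sqrt_pos.2 (hq t ht)).ne'
      refine ((hy t ht k).fun_div (hr t ht) h3).congr_deriv ?_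
      rw [eval_WW_inr]
      simp only [proj, Sum.elim_inl, Sum.elim_inr]
      simp only [mul_div_assoc', ← Finset.sum_div]
      field_simp
  have hV : ∀ t, 0 ≤ t → HasDerivAt (fun s => eval (proj (x s) (y s)) V)
      (eval (proj (x t) (y t)) (PolyFlow.lie (WW F) V)) t := by
    intro t ht
    refine (hasDerivAt_eval V (hu t ht)).congr_deriv ?_
    rw [PolyFlow.lie_eq, map_sum]
    refine Finset.sum_congr rfl fun i _ => ?_
    rw [map_mul, mul_comm]
  refine ⟨2 * M, fun T hT => ?_⟩
  have := anti_aux (u := fun s => Real.log (√(∑ i, y s i ^ 2)) + eval (proj (x s) (y s)) V - U * s)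
    (fun t ht => ((hl t ht).fun_add (hV t ht)).fun_sub ((hasDerivAt_id t).const_mul U))
    (fun t ht => by
      have h1 := hmem t ht _ hP
      rw [Ppoly_eq] at h1
      simp only [map_sub, eval_C] at h1
      linarith) hT
  simp only [hy0, Real.sqrt_one, Real.log_one, mul_zero, sub_zero, zero_add] at this
  have h1 := (abs_le.1 (hM _ (hmem T hT))).1
  have h2 := (abs_le.1 (hM _ (hmem 0 le_rfl))).2
  linarith

end traj
end LyapSOS

namespace LyapSOS

variable {n I J : ℕ} {F : Fin n → MvPolynomial (Fin n) ℝ}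
    {f : EuclideanSpace ℝ (Fin n) → EuclideanSpace ℝ (Fin n)}
    {g : Fin I → MvPolynomial (Fin n) ℝ} {h : Fin J → MvPolynomial (Fin n) ℝ}

theorem hasDerivAt_euc {x : ℝ → EuclideanSpace ℝ (Fin n)} {v : EuclideanSpace ℝ (Fin n)} {t : ℝ} :
    HasDerivAt x v t ↔ ∀ i, HasDerivAt (fun s => x s i) (v i) t := by
  constructor
  · intro hx i
    exact ((EuclideanSpace.proj i : EuclideanSpace ℝ (Fin n) →L[ℝ] ℝ).hasFDerivAt.comp_hasDerivAt
      t hx :)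
  · intro hx
    have h1 : HasDerivAt (fun s => fun i => x s i) (fun i => v i) t := hasDerivAt_pi.2 hx
    exact ((PiLp.continuousLinearEquiv 2 ℝ (fun _ : Fin n => ℝ)).symm.hasFDerivAt.comp_hasDerivAt
      t h1 :)

theorem fderiv_apply (hfF : ∀ (v : EuclideanSpace ℝ (Fin n)) (i : Fin n),
    f v i = eval (fun k => v k) (F i)) (x v : EuclideanSpace ℝ (Fin n)) (k : Fin n) :
    fderiv ℝ f x v k = ∑ i, eval (fun k => x k) (pderiv i (F k)) * v i := by
  have hk : ∀ k, HasFDerivAt (fun v => f v k)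
      ((∑ i, eval (fun k => x k) (pderiv i (F k)) •
        (ContinuousLinearMap.proj i : (Fin n → ℝ) →L[ℝ] ℝ)).comp
        (PiLp.continuousLinearEquiv 2 ℝ (fun _ : Fin n => ℝ)).toContinuousLinearMap) x := by
    intro k
    have h1 := (hasFDerivAt_eval (F k) (fun k => x k)).comp x
      (PiLp.continuousLinearEquiv 2 ℝ (fun _ : Fin n => ℝ)).hasFDerivAt
    have e : (fun v => f v k) = fun v : EuclideanSpace ℝ (Fin n) => eval (fun k => v k) (F k) := by
      ext v; exact hfF v k
    rw [e]
    exact h1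
  have hd : DifferentiableAt ℝ f x := differentiableAt_euclidean.2 fun k => (hk k).differentiableAt
  have h2 := (EuclideanSpace.proj k : EuclideanSpace ℝ (Fin n) →L[ℝ] ℝ).hasFDerivAt.comp x
    hd.hasFDerivAt
  have h3 := HasFDerivAt.unique h2 (hk k)
  have h4 := congrArg (fun L => L v) h3
  simpa using h4

theorem norm_euc (v : EuclideanSpace ℝ (Fin n)) : ‖v‖ = √(∑ i, v i ^ 2) := by
  simp [EuclideanSpace.norm_eq]

section
variable (hfF : ∀ (v : EuclideanSpace ℝ (Fin n)) (i : Fin n), f v i = eval (fun k => v k) (F i))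
    (hQ : ArchQM (QM g h)) {x y : ℝ → EuclideanSpace ℝ (Fin n)}
    (hx : ∀ t : ℝ, 0 ≤ t → HasDerivAt x (f (x t)) t)
    (hy : ∀ t : ℝ, 0 ≤ t → HasDerivAt y (fderiv ℝ f (x t) (y t)) t)
    (hB : ∀ t, 0 ≤ t → (∀ i, 0 ≤ eval (fun k => x t k) (g i)) ∧ ∀ j, eval (fun k => x t k) (h j) = 0)
    (hy0 : ‖y 0‖ = 1)
include hfF hQ hy hB hy0

theorem exponent_bounds : ∃ c : ℝ, ∀ T : ℝ, 0 < T → -c ≤ (1 / T) * Real.log ‖y T‖ ∧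
    (1 / T) * Real.log ‖y T‖ ≤ c := by
  have hy' : ∀ t, 0 ≤ t → ∀ k, HasDerivAt (fun s => y s k)
      (∑ i, eval (fun k => x t k) (pderiv i (F k)) * y t i) t := by
    intro t ht k
    rw [← fderiv_apply hfF]
    exact hasDerivAt_euc.1 (hy t ht) k
  have hy1 : ∑ i, y 0 i ^ 2 = 1 := by
    rw [norm_euc, Real.sqrt_eq_one] at hy0; exact hy0
  obtain ⟨c, hc⟩ := q_bounds hQ (x := fun t k => x t k) (y := fun t k => y t k) hy' hB hy1
  refine ⟨c, fun T hT => ?_⟩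
  obtain ⟨h1, h2⟩ := hc T hT.le
  have h0 : 0 < ∑ i, y T i ^ 2 := (Real.exp_pos _).trans_le h1
  rw [norm_euc, Real.log_sqrt h0.le]
  have h3 := (Real.le_log_iff_exp_le h0).2 h1
  have h4 := (Real.log_le_iff_le_exp h0).2 h2
  have e : 1 / T * (Real.log (∑ i, y T i ^ 2) / 2) = (Real.log (∑ i, y T i ^ 2) / 2) / T := by ring
  rw [e, le_div_iff₀ hT, div_le_iff₀ hT]
  constructor <;> linarith

theorem exponent_bdd :
    IsBoundedUnder (· ≤ ·) atTop (fun T : ℝ => (1 / T) * Real.log ‖y T‖) ∧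
    IsCoboundedUnder (· ≤ ·) atTop (fun T : ℝ => (1 / T) * Real.log ‖y T‖) := by
  obtain ⟨c, hc⟩ := exponent_bounds hfF hQ hy hB hy0
  constructor
  · refine isBoundedUnder_of_eventually_le (a := c) ?_
    filter_upwards [eventually_gt_atTop 0] with T hT using (hc T hT).2
  · refine IsBoundedUnder.isCoboundedUnder_le (isBoundedUnder_of_eventually_ge (a := -c) ?_)
    filter_upwards [eventually_gt_atTop 0] with T hT using (hc T hT).1

include hx in
theorem exponent_le {U : ℝ} {V : MvPolynomial (Fin n ⊕ Fin n) ℝ} (hP : Ppoly F U V ∈ QM g h) :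
    limsup (fun T : ℝ => (1 / T) * Real.log ‖y T‖) atTop ≤ U := by
  have hx' : ∀ t, 0 ≤ t → ∀ i, HasDerivAt (fun s => x s i) (eval (fun k => x t k) (F i)) t := by
    intro t ht i
    rw [← hfF]
    exact hasDerivAt_euc.1 (hx t ht) i
  have hy' : ∀ t, 0 ≤ t → ∀ k, HasDerivAt (fun s => y s k)
      (∑ i, eval (fun k => x t k) (pderiv i (F k)) * y t i) t := by
    intro t ht k
    rw [← fderiv_apply hfF]
    exact hasDerivAt_euc.1 (hy t ht) k
  have hy1 : ∑ i, y 0 i ^ 2 = 1 := by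
    rw [norm_euc, Real.sqrt_eq_one] at hy0; exact hy0
  obtain ⟨M, hM⟩ := log_bound hQ (x := fun t k => x t k) (y := fun t k => y t k) hx' hy' hB hy1 hP
  refine le_of_forall_pos_le_add fun ε hε => ?_
  refine limsup_le_of_le (exponent_bdd hfF hQ hy hB hy0).2 ?_
  filter_upwards [eventually_gt_atTop 0, eventually_ge_atTop (M / ε)] with T hT hT2
  have h1 := hM T hT.le
  rw [div_le_iff₀ hε] at hT2
  rw [norm_euc, one_div, ← div_eq_inv_mul, div_le_iff₀ hT]
  refine h1.trans ?_
  linarith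

end

theorem exists_exponent (hfF : ∀ (v : EuclideanSpace ℝ (Fin n)) (i : Fin n),
      f v i = eval (fun k => v k) (F i))
    (hQ : ArchQM (QM g h)) {B : Set (EuclideanSpace ℝ (Fin n))}
    (hBdef : B = {v : EuclideanSpace ℝ (Fin n) |
      (∀ i, 0 ≤ eval (fun k => v k) (g i)) ∧ ∀ j, eval (fun k => v k) (h j) = 0})
    (hBinv : ∀ x : ℝ → EuclideanSpace ℝ (Fin n),
      (∀ t : ℝ, 0 ≤ t → HasDerivAt x (f (x t)) t) → x 0 ∈ B → ∀ t : ℝ, 0 ≤ t → x t ∈ B)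
    {U0 U : ℝ} (hinf : ∀ V, Ppoly F U0 V ∉ QM g h) (hU : U < U0) :
    ∃ x y : ℝ → EuclideanSpace ℝ (Fin n),
        (∀ t : ℝ, 0 ≤ t → HasDerivAt x (f (x t)) t) ∧ x 0 ∈ B ∧
        (∀ t : ℝ, 0 ≤ t → HasDerivAt y (fderiv ℝ f (x t) (y t)) t) ∧ ‖y 0‖ = 1 ∧
        U ≤ limsup (fun T : ℝ => (1 / T) * Real.log ‖y T‖) atTop := by
  obtain ⟨γ, a, τ, hτ, h0, ha0, hγ, ha, hk, hkm⟩ := PolyFlow.exists_trajectory hQ (WW F) (PhiPoly F)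
    (U0 := U0) (U := U) (fun V => by rw [← Ppoly_eq]; exact hinf V) hU
  set x : ℝ → EuclideanSpace ℝ (Fin n) := fun t => WithLp.toLp 2 (fun i => γ t (Sum.inl i)) with hxdef
  set y : ℝ → EuclideanSpace ℝ (Fin n) :=
    fun t => WithLp.toLp 2 (fun i => Real.exp (a t) * γ t (Sum.inr i)) with hydef
  have hx : ∀ t : ℝ, 0 ≤ t → HasDerivAt x (f (x t)) t := by
    intro t ht
    rw [hasDerivAt_euc]
    intro i
    rw [hfF]
    have := hasDerivAt_pi.1 (hγ t ht) (Sum.inl i)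
    rw [eval_WW_inl] at this
    exact this
  have hy : ∀ t : ℝ, 0 ≤ t → HasDerivAt y (fderiv ℝ f (x t) (y t)) t := by
    intro t ht
    rw [hasDerivAt_euc]
    intro k
    rw [fderiv_apply hfF]
    have h1 := hasDerivAt_pi.1 (hγ t ht) (Sum.inr k)
    rw [eval_WW_inr] at h1
    refine ((ha t ht).exp.fun_mul h1).congr_deriv ?_
    have e : ∑ i, eval (fun k => x t k) (pderiv i (F k)) * y t i = Real.exp (a t) *
        ∑ i, eval (fun k => γ t (Sum.inl k)) (pderiv i (F k)) * γ t (Sum.inr i) := by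
      rw [Finset.mul_sum]
      refine Finset.sum_congr rfl fun i _ => ?_
      simp only [hxdef, hydef]
      ring
    rw [e]
    ring
  have hxB : x 0 ∈ B := by
    rw [hBdef]
    exact ((mem_pos (γ 0)).1 h0).1
  have hynorm : ∀ k : ℕ, ‖y (k * τ)‖ = Real.exp (a (k * τ)) := by
    intro k
    have h1 := ((mem_pos _).1 (hkm k)).2
    rw [norm_euc]
    simp only [hydef, mul_pow, ← Finset.mul_sum, h1, mul_one]
    exact Real.sqrt_sq (Real.exp_pos _).le
  have hy0 : ‖y 0‖ = 1 := by
    have := hynorm 0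
    simpa [ha0] using this
  refine ⟨x, y, hx, hxB, hy, hy0, ?_⟩
  have hB : ∀ t, 0 ≤ t → (∀ i, 0 ≤ eval (fun k => x t k) (g i)) ∧
      ∀ j, eval (fun k => x t k) (h j) = 0 := by
    intro t ht
    have := hBinv x hx hxB t ht
    rw [hBdef] at this
    exact this
  refine le_limsup_of_frequently_le ?_ (exponent_bdd hfF hQ hy hB hy0).1
  have ht : Tendsto (fun k : ℕ => (k : ℝ) * τ) atTop atTop :=
    tendsto_natCast_atTop_atTop.atTop_mul_const hτ
  refine ht.frequently (Eventually.frequently ?_)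
  filter_upwards [eventually_gt_atTop 0] with k hk0
  have hk' : (0:ℝ) < k * τ := by positivity
  rw [hynorm, Real.log_exp, one_div, ← div_eq_inv_mul, le_div_iff₀ hk']
  calc U * (k * τ) = k * (τ * U) := by ring
    _ ≤ _ := hk k

theorem final_order {E D : Set ℝ} (h1 : ∀ e ∈ E, ∀ U ∈ D, e ≤ U)
    (h2 : ∀ U0, U0 ∉ D → ∀ U < U0, ∃ e ∈ E, U ≤ e) : sSup E = sInf D := by
  rcases D.eq_empty_or_nonempty with rfl | hD
  · rw [Real.sInf_empty]
    apply Real.sSup_of_not_bddAbove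
    rintro ⟨b, hb⟩
    obtain ⟨e, he, hle⟩ := h2 (b + 2) (by simp) (b + 1) (by linarith)
    have := hb he
    linarith
  · rcases E.eq_empty_or_nonempty with rfl | hE
    · have : D = Set.univ := by
        ext U0
        simp only [Set.mem_univ, iff_true]
        by_contra hU
        obtain ⟨e, he, _⟩ := h2 U0 hU (U0 - 1) (by linarith)
        exact he
      rw [this, Real.sSup_empty, Real.sInf_univ]
    · refine le_antisymm (csSup_le hE fun e he => le_csInf hD fun U hU => h1 e he U hU) ?_
      by_contra! hlt
      obtain ⟨U0, ha, hb⟩ := exists_between hlt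
      obtain ⟨U, hc, hd⟩ := exists_between ha
      obtain ⟨e0, he0⟩ := hE
      have hDb : BddBelow D := ⟨e0, fun U hU => h1 e0 he0 U hU⟩
      obtain ⟨U1, hU1⟩ := hD
      have hEb : BddAbove E := ⟨U1, fun e he => h1 e he U1 hU1⟩
      obtain ⟨e, he, hle⟩ := h2 U0 (fun hU0 => (csInf_le hDb hU0).not_gt hb) U hd
      exact (le_csSup hEb he).not_gt (hc.trans_le hle)

end LyapSOS

/-- Sharpness of the SOS bounds on the maximal Lyapunov exponent: if `f` has polynomial
components `F`, the semialgebraic set `B = {x : gᵢ(x) ≥ 0, hⱼ(x) = 0}` is compact, forward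
invariant, and its specification is Archimedean, then the maximal Lyapunov exponent `μ*_B`
equals the infimum of `U` over all SOS certificates
`(U, V, ρ₀,…,ρ_J, σ₁,…,σ_I)` with `P − Σᵢ σᵢ gᵢ − Σ_{j=0}^J ρⱼ hⱼ` SOS. -/
theorem statement10 {n I J : ℕ}
    (F : Fin n → MvPolynomial (Fin n) ℝ)
    (f : EuclideanSpace ℝ (Fin n) → EuclideanSpace ℝ (Fin n))
    (hfF : ∀ (v : EuclideanSpace ℝ (Fin n)) (i : Fin n), f v i = eval (fun k => v k) (F i))
    (g : Fin I → MvPolynomial (Fin n) ℝ) (h : Fin J → MvPolynomial (Fin n) ℝ)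
    (B : Set (EuclideanSpace ℝ (Fin n)))
    (hBdef : B = {v : EuclideanSpace ℝ (Fin n) |
      (∀ i, 0 ≤ eval (fun k => v k) (g i)) ∧ ∀ j, eval (fun k => v k) (h j) = 0})
    (hBcomp : IsCompact B)
    (hBinv : ∀ x : ℝ → EuclideanSpace ℝ (Fin n),
      (∀ t : ℝ, 0 ≤ t → HasDerivAt x (f (x t)) t) → x 0 ∈ B → ∀ t : ℝ, 0 ≤ t → x t ∈ B)
    (hArch : ∃ (R : ℝ) (τ₀ : MvPolynomial (Fin n) ℝ) (τ : Fin I → MvPolynomial (Fin n) ℝ)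
        (π : Fin J → MvPolynomial (Fin n) ℝ), IsSOS τ₀ ∧ (∀ i, IsSOS (τ i)) ∧
        C R - ∑ k, X k ^ 2 = τ₀ + ∑ i, τ i * g i + ∑ j, π j * h j) :
    sSup {a : ℝ | ∃ x y : ℝ → EuclideanSpace ℝ (Fin n),
        (∀ t : ℝ, 0 ≤ t → HasDerivAt x (f (x t)) t) ∧ x 0 ∈ B ∧
        (∀ t : ℝ, 0 ≤ t → HasDerivAt y (fderiv ℝ f (x t) (y t)) t) ∧ ‖y 0‖ = 1 ∧
        a = limsup (fun T : ℝ => (1 / T) * Real.log ‖y T‖) atTop} =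
    sInf {U : ℝ | ∃ (V ρ₀ : MvPolynomial (Fin n ⊕ Fin n) ℝ)
        (ρ : Fin J → MvPolynomial (Fin n ⊕ Fin n) ℝ)
        (σ : Fin I → MvPolynomial (Fin n ⊕ Fin n) ℝ),
        (∀ i, IsSOS (σ i)) ∧
        IsSOS (Ppoly F U V - ∑ i, σ i * rename Sum.inl (g i) - ρ₀ * hZero n
          - ∑ j, ρ j * rename Sum.inl (h j))} := by
  have hQ : ArchQM (LyapSOS.QM g h) := LyapSOS.qm_arch hArch
  refine LyapSOS.final_order ?_ ?_
  · rintro e ⟨x, y, hx, hx0, hy, hy0, rfl⟩ U ⟨V, ρ₀, ρ, σ, hσ, hP⟩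
    have hB : ∀ t, 0 ≤ t → (∀ i, 0 ≤ eval (fun k => x t k) (g i)) ∧
        ∀ j, eval (fun k => x t k) (h j) = 0 := by
      intro t ht
      have := hBinv x hx hx0 t ht
      rw [hBdef] at this
      exact this
    exact LyapSOS.exponent_le hfF hQ hx hy hB hy0 (V := V) ⟨ρ₀, ρ, σ, hσ, hP⟩
  · intro U0 hU0 U hU
    obtain ⟨x, y, hx, hx0, hy, hy0, hle⟩ := LyapSOS.exists_exponent hfF hQ hBdef hBinv
      (U0 := U0) (U := U) (fun V hV => by
        obtain ⟨ρ₀, ρ, σ, hσ, hP⟩ := hV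
        exact hU0 ⟨V, ρ₀, ρ, σ, hσ, hP⟩) hU
    exact ⟨_, ⟨x, y, hx, hx0, hy, hy0, rfl⟩, hle⟩
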